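/- arXiv:0904.3211 — 6 statements merged into one kernel-verified Lean document; each statement's English description precedes it below -/
import Mathlib

section
/- Let H be a complex Hilbert space, A a unitary operator on H, and f₀ ∈ H with ‖f₀‖ = 1. Set f_k = A^k f₀ for k ∈ ℤ and a_j = ⟨A^j f₀, f₀⟩. Assume (a_j)_{j∈ℤ} ∈ ℓ¹(ℤ), that the continuous function α(p) = Σ_{j∈ℤ} a_j e^{ipj} is strictly positive for all p ∈ [0,2π), and that the Fourier coefficients c_l = (1/2π) ∫_0^{2π} e^{-ipl} α(p)^{-1/2} dp satisfy (c_l) ∈ ℓ¹(ℤ). Then the vectors φ_n = Σ_{k∈ℤ} c_k f_{k+n} (the series converging absolutely in H) form an orthonormal family: ⟨φ_n, φ_m⟩ = δ_{n,m} for all n, m ∈ ℤ. -/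
open Real Complex

local notation "⟪" x ", " y "⟫" => @inner ℂ _ _ x y

section FourierCoefficients

open AddCircle

variable {T : ℝ} [Fact (0 < T)] {ι : Type*}

/-- Taking a Fourier coefficient commutes with uniformly convergent sums. -/
lemma HasSum.fourierCoeff {u : ι → C(AddCircle T, ℂ)} {F : C(AddCircle T, ℂ)}
    (h : HasSum u F) (n : ℤ) :
    HasSum (fun i => _root_.fourierCoeff (u i) n) (_root_.fourierCoeff F n) := by
  have hL := ((innerSL ℂ (fourierBasis (T := T) n)).comp
    (ContinuousMap.toLp (E := ℂ) 2 haarAddCircle ℂ)).hasSum h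
  simpa only [Function.comp_def, ContinuousLinearMap.comp_apply, innerSL_apply_apply,
    ← HilbertBasis.repr_apply_apply, fourierBasis_repr, fourierCoeff_toLp] using hL

lemma fourierCoeff_mul_smul_fourier (F : C(AddCircle T, ℂ)) (z : ℂ) (k n : ℤ) :
    fourierCoeff (F * z • fourier k : C(AddCircle T, ℂ)) n = z * fourierCoeff F (n - k) := by
  rw [← fourierCoeff.const_mul]
  unfold fourierCoeff
  congr 1 with t
  have : -(n - k) = -n + k := by ring
  simp only [this, fourier_add, ContinuousMap.mul_apply, ContinuousMap.smul_apply, smul_eq_mul]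
  ring

/-- The Fourier coefficients of a product with an absolutely convergent trigonometric series
are given by a convolution. -/
lemma hasSum_fourierCoeff_mul {c : ι → ℂ} {ψ : ι → ℤ} {G : C(AddCircle T, ℂ)}
    (hG : HasSum (fun i => c i • fourier (ψ i)) G) (F : C(AddCircle T, ℂ)) (n : ℤ) :
    HasSum (fun i => c i * fourierCoeff F (n - ψ i))
      (fourierCoeff (F * G : C(AddCircle T, ℂ)) n) := by
  simpa only [fourierCoeff_mul_smul_fourier] using (hG.mul_left F).fourierCoeff n

lemma fourierCoeff_one (n : ℤ) :
    fourierCoeff ((1 : C(AddCircle T, ℂ)) : AddCircle T → ℂ) n = if n = 0 then 1 else 0 := by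
  have h : (1 : C(AddCircle T, ℂ)) = fourier 0 := by ext; simp
  rw [h, fourierCoeff_fourier]
  simp [Pi.single_apply]

lemma fourierCoeff_eq_of_hasSum {c : ℤ → ℂ} {G : C(AddCircle T, ℂ)}
    (hG : HasSum (fun i => c i • fourier i) G) (n : ℤ) : fourierCoeff G n = c n := by
  have h := hasSum_fourierCoeff_mul (ψ := id) hG 1 n
  rw [one_mul] at h
  refine h.unique ?_
  convert hasSum_ite_eq n (c n) using 2 with i
  simp only [fourierCoeff_one, id, sub_eq_zero, eq_comm (a := n)]
  split_ifs with hi <;> simp [hi]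

lemma summable_smul_fourier {c : ℤ → ℂ} (hc : Summable fun j => ‖c j‖) :
    Summable fun j => c j • fourier (T := T) j :=
  .of_norm <| by simpa [norm_smul, fourier_norm] using hc

end FourierCoefficients

section Hilbert

variable {H ι : Type*} [NormedAddCommGroup H] [InnerProductSpace ℂ H]

lemma HasSum.inner_smul_left {c : ι → ℂ} {v : ι → H} {x : H}
    (h : HasSum (fun k => c k • v k) x) (y : H) :
    HasSum (fun k => starRingEnd ℂ (c k) * ⟪v k, y⟫) ⟪x, y⟫ := by
  simpa [Function.comp_def] using (innerSLFlip ℂ y).hasSum h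

lemma HasSum.inner_smul_right {c : ι → ℂ} {v : ι → H} {x : H}
    (h : HasSum (fun k => c k • v k) x) (y : H) :
    HasSum (fun k => c k * ⟪y, v k⟫) ⟪y, x⟫ := by
  simpa [Function.comp_def, _root_.inner_smul_right] using (innerSL ℂ y).hasSum h

lemma LinearIsometryEquiv.inner_zpow_zpow (A : H ≃ₗᵢ[ℂ] H) (f : H) (i j : ℤ) :
    ⟪(A ^ i) f, (A ^ j) f⟫ = ⟪(A ^ (i - j)) f, f⟫ := by
  have h : (A ^ i) f = (A ^ j) ((A ^ (i - j)) f) := by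
    rw [← Function.comp_apply (f := A ^ j), ← LinearIsometryEquiv.coe_mul, ← zpow_add,
      add_sub_cancel]
  rw [h, LinearIsometryEquiv.inner_map_map]

end Hilbert

/-- Orthonormalization for `N = 1`: given a unitary `A` on a complex Hilbert space `H`,
a unit vector `f₀`, overlap coefficients `a_j = ⟨A^j f₀, f₀⟩` in `ℓ¹(ℤ)` with
`α(p) = Σ_j a_j e^{ipj}` strictly positive on `[0,2π)`, and Fourier coefficients
`c_l = (1/2π)∫_0^{2π} e^{-ipl} α(p)^{-1/2} dp` in `ℓ¹(ℤ)`, the vectors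
`φ_n = Σ_k c_k A^{k+n} f₀` form an orthonormal family. -/
theorem stmt4 {H : Type*} [NormedAddCommGroup H] [InnerProductSpace ℂ H] [CompleteSpace H]
    (A : H ≃ₗᵢ[ℂ] H) (f₀ : H) (hf₀ : ‖f₀‖ = 1)
    (a : ℤ → ℂ) (ha : ∀ j : ℤ, a j = ⟪(A ^ j) f₀, f₀⟫)
    (hal1 : Summable fun j : ℤ => ‖a j‖)
    (α : ℝ → ℂ) (hα : ∀ p : ℝ, α p = ∑' j : ℤ, a j * Complex.exp (Complex.I * (p : ℂ) * (j : ℂ)))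
    (hαpos : ∀ p ∈ Set.Ico (0 : ℝ) (2 * π), 0 < (α p).re ∧ (α p).im = 0)
    (c : ℤ → ℂ)
    (hc : ∀ l : ℤ, c l = (1 / (2 * π) : ℝ) *
      ∫ p in (0 : ℝ)..(2 * π),
        Complex.exp (-(Complex.I * (p : ℂ) * (l : ℂ))) / ((Real.sqrt ((α p).re) : ℝ) : ℂ))
    (hcl1 : Summable fun l : ℤ => ‖c l‖)
    (φ : ℤ → H) (hφ : ∀ n : ℤ, φ n = ∑' k : ℤ, c k • (A ^ (k + n)) f₀) :
    ∀ n m : ℤ, ⟪φ n, φ m⟫ = if n = m then 1 else 0 := by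
  intro n m
  have : Fact (0 < 2 * π) := ⟨two_pi_pos⟩
  obtain ⟨S, hS⟩ := summable_smul_fourier (T := 2 * π) hal1
  have hSα (p : ℝ) : S p = α p := by
    rw [hα, ← ContinuousMap.evalCLM_apply ℂ (p : AddCircle (2 * π)) S,
      ← ((ContinuousMap.evalCLM ℂ (p : AddCircle (2 * π))).hasSum hS).tsum_eq]
    refine tsum_congr fun j => ?_
    simp only [ContinuousMap.evalCLM_apply, ContinuousMap.smul_apply,
      smul_eq_mul, fourier_coe_apply]
    congr 2
    push_cast
    field_simp
  have hSpos (x : AddCircle (2 * π)) : 0 < (S x).re ∧ (S x).im = 0 := by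
    obtain ⟨p, hp, rfl⟩ := x.eq_coe_Ico
    rw [hSα]
    exact hαpos p hp
  let G : C(AddCircle (2 * π), ℂ) :=
    { toFun := fun x => ((√(S x).re)⁻¹ : ℝ)
      continuous_toFun := Complex.continuous_ofReal.comp <|
        Continuous.inv₀ (by fun_prop) fun x => (Real.sqrt_pos.2 (hSpos x).1).ne' }
  have hGc : fourierCoeff G = c := by
    funext l
    rw [hc, fourierCoeff_eq_intervalIntegral _ _ 0, zero_add, Complex.real_smul]
    congr 1
    refine intervalIntegral.integral_congr fun p _ => ?_
    simp only [G, ContinuousMap.coe_mk, hSα, smul_eq_mul, fourier_coe_apply, div_eq_mul_inv,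
      Complex.ofReal_inv]
    congr 2
    push_cast
    field_simp
  have hG : HasSum (fun k => c k • fourier k) G := by
    have := hasSum_fourier_series_of_summable (f := G) (by rw [hGc]; exact hcl1.of_norm)
    rwa [hGc] at this
  have hG' : HasSum (fun k => starRingEnd ℂ (c k) • fourier (-k)) G := by
    have hstar : star G = G := by
      ext x
      exact Complex.conj_ofReal _
    convert! hG.star using 1
    · ext k x
      simp
    · exact hstar.symm
  have hSGG : S * G * G = 1 := by
    ext x
    have hx : S x = ((S x).re : ℝ) := Complex.ext rfl (by simp [(hSpos x).2])
    have hr := Real.mul_self_sqrt (hSpos x).1.le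
    have hne := (Real.sqrt_pos.2 (hSpos x).1).ne'
    have hreal : (S x).re * (√(S x).re)⁻¹ * (√(S x).re)⁻¹ = 1 := by
      field_simp
      rw [sq, hr]
    simp only [ContinuousMap.mul_apply, ContinuousMap.one_apply]
    rw [hx]
    simp only [G, ContinuousMap.coe_mk]
    exact_mod_cast hreal
  have hφ' (n : ℤ) : HasSum (fun k => c k • (A ^ (k + n)) f₀) (φ n) := by
    rw [hφ]
    refine (Summable.of_norm ?_).hasSum
    simpa [norm_smul, hf₀] using hcl1
  have hinner (k : ℤ) :
      ⟪(A ^ (k + n)) f₀, φ m⟫ = fourierCoeff (S * G : C(AddCircle (2 * π), ℂ)) (n - m - -k) := by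
    refine ((hφ' m).inner_smul_right _).unique ?_
    convert! hasSum_fourierCoeff_mul (ψ := id) hG S (n - m - -k) using 3 with l
    rw [A.inner_zpow_zpow, ← ha, fourierCoeff_eq_of_hasSum hS]
    congr 1
    simp only [id]
    ring
  have hsum := (hφ' n).inner_smul_left (φ m)
  simp only [hinner] at hsum
  rw [hsum.unique (hasSum_fourierCoeff_mul hG' (S * G) (n - m)), hSGG, fourierCoeff_one]
  simp only [sub_eq_zero]
end

section
/- Let H be a complex Hilbert space, T₁ and T₂ commuting unitary operators on H, and g ∈ H with ‖g‖ = 1. For n = (n₁,n₂) ∈ ℤ² set g_n = T₁^{n₁} T₂^{n₂} g and I_m = ⟨T₁^{m₁} T₂^{m₂} g, g⟩. Assume (I_m) ∈ ℓ¹(ℤ²), that F(P) = Σ_{m∈ℤ²} I_m e^{i(P₁m₁ + P₂m₂)} is strictly positive for all P ∈ [0,2π)², and that the Fourier coefficients c_k = (2π)^{-2} ∫_0^{2π}∫_0^{2π} e^{-i(P₁k₁+P₂k₂)} F(P)^{-1/2} dP₁ dP₂ satisfy (c_k) ∈ ℓ¹(ℤ²). Then the vectors Ψ_n = Σ_{k∈ℤ²}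 c_k g_{k+n} (converging absolutely in H) form an orthonormal family: ⟨Ψ_n, Ψ_s⟩ = δ_{n,s} for all n, s ∈ ℤ². -/
open Real Complex

local notation "⟪" x ", " y "⟫" => @inner ℂ _ _ x y

open MeasureTheory UnitAddTorus ComplexConjugate

namespace UnitAddTorus

variable {d : Type*} [Fintype d]

section Coefficients

/-- The normalized Haar measure, which `UnitAddTorus.mFourierCoeff` integrates against. -/
noncomputable local instance : MeasureSpace UnitAddCircle := ⟨AddCircle.haarAddCircle⟩

local instance : Measure.IsAddHaarMeasure (volume : Measure UnitAddCircle) :=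
  inferInstanceAs (Measure.IsAddHaarMeasure AddCircle.haarAddCircle)

local instance : IsProbabilityMeasure (volume : Measure UnitAddCircle) :=
  inferInstanceAs (IsProbabilityMeasure AddCircle.haarAddCircle)

theorem mFourierCoeff_eq_inner (f : C(UnitAddTorus d, ℂ)) (n : d → ℤ) :
    mFourierCoeff f n = ⟪mFourierLp 2 n, f.toLp 2 volume ℂ⟫ := by
  rw [← mFourierCoeff_toLp]
  exact (mFourierBasis_repr _ n).symm.trans
    (by rw [HilbertBasis.repr_apply_apply, coe_mFourierBasis])

theorem hasSum_mFourierCoeff {ι : Type*} {u : ι → C(UnitAddTorus d, ℂ)}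
    {f : C(UnitAddTorus d, ℂ)} (h : HasSum u f) (n : d → ℤ) :
    HasSum (fun i => mFourierCoeff (u i) n) (mFourierCoeff f n) := by
  simp only [mFourierCoeff_eq_inner]
  exact ((innerSL ℂ (mFourierLp 2 n)).comp (ContinuousMap.toLp 2 volume ℂ)).hasSum h

theorem mFourierCoeff_mFourier [DecidableEq d] (m n : d → ℤ) :
    mFourierCoeff (mFourier m) n = if n = m then 1 else 0 := by
  rw [mFourierCoeff_eq_inner]
  exact orthonormal_iff_ite.mp orthonormal_mFourier n m

end Coefficients

theorem mFourierCoeff_smul_mFourier_mul (a : ℂ) (m n : d → ℤ) (f : C(UnitAddTorus d, ℂ)) :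
    mFourierCoeff (a • mFourier m * f) n = a * mFourierCoeff f (n - m) := by
  simp only [mFourierCoeff, ← integral_const_mul]
  refine integral_congr_ae (.of_forall fun t => ?_)
  simp only [neg_sub, sub_eq_add_neg m n, mFourier_add, ContinuousMap.mul_apply,
    ContinuousMap.smul_apply, smul_eq_mul]
  ring

/-- The point of the two-dimensional torus with angles `P` in radians. -/
noncomputable def ofAngles (P : ℝ × ℝ) : UnitAddTorus (Fin 2) :=
  ![((P.1 / (2 * π) : ℝ) : UnitAddCircle), ((P.2 / (2 * π) : ℝ) : UnitAddCircle)]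

theorem mFourier_ofAngles (m : ℤ × ℤ) (P : ℝ × ℝ) :
    mFourier ![m.1, m.2] (ofAngles P) =
      Complex.exp (Complex.I * ((P.1 : ℂ) * (m.1 : ℂ) + (P.2 : ℂ) * (m.2 : ℂ))) := by
  have hpi : (π : ℂ) ≠ 0 := by exact_mod_cast pi_ne_zero
  simp only [mFourier, ofAngles, ContinuousMap.coe_mk, Fin.prod_univ_two, Matrix.cons_val_zero,
    Matrix.cons_val_one, fourier_coe_apply, ← Complex.exp_add]
  congr 1
  push_cast
  field_simp

theorem exists_ofAngles_eq (t : UnitAddTorus (Fin 2)) :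
    ∃ P : ℝ × ℝ, P.1 ∈ Set.Ico (0 : ℝ) (2 * π) ∧ P.2 ∈ Set.Ico (0 : ℝ) (2 * π) ∧
      ofAngles P = t := by
  have key (x : UnitAddCircle) :
      ∃ p ∈ Set.Ico (0 : ℝ) (2 * π), ((p / (2 * π) : ℝ) : UnitAddCircle) = x := by
    obtain ⟨y, hy, rfl⟩ := AddCircle.eq_coe_Ico x
    exact ⟨y * (2 * π), ⟨by have := hy.1; positivity,
      mul_lt_of_lt_one_left two_pi_pos hy.2⟩, by rw [mul_div_cancel_right₀ _ two_pi_pos.ne']⟩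
  obtain ⟨p, hp, hpx⟩ := key (t 0)
  obtain ⟨q, hq, hqx⟩ := key (t 1)
  refine ⟨(p, q), hp, hq, ?_⟩
  ext i
  fin_cases i
  · exact hpx
  · exact hqx

theorem mFourierCoeff_eq_angular_integral (f : C(UnitAddTorus (Fin 2), ℂ)) (k : ℤ × ℤ) :
    mFourierCoeff f ![k.1, k.2] = ((1 / (2 * π) ^ 2 : ℝ) : ℂ) *
      ∫ P₁ in (0 : ℝ)..(2 * π), ∫ P₂ in (0 : ℝ)..(2 * π),
        Complex.exp (-(Complex.I * ((P₁ : ℂ) * (k.1 : ℂ) + (P₂ : ℂ) * (k.2 : ℂ)))) *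
          f (ofAngles (P₁, P₂)) := by
  set n : Fin 2 → ℤ := ![k.1, k.2] with hn
  let e : ℝ × ℝ → ℂ := fun p =>
    mFourier (-n) (![(p.1 : UnitAddCircle), (p.2 : UnitAddCircle)] : UnitAddTorus (Fin 2)) *
      f (![(p.1 : UnitAddCircle), (p.2 : UnitAddCircle)] : UnitAddTorus (Fin 2))
  have hcoe : Continuous fun p : ℝ × ℝ =>
      (![(p.1 : UnitAddCircle), (p.2 : UnitAddCircle)] : UnitAddTorus (Fin 2)) := by
    refine continuous_pi fun i => ?_
    fin_cases i
    · exact (AddCircle.continuous_mk' 1).comp continuous_fst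
    · exact (AddCircle.continuous_mk' 1).comp continuous_snd
  have he : Continuous e :=
    ((mFourier (-n)).continuous.comp hcoe).mul (f.continuous.comp hcoe)
  have hval (P₁ P₂ : ℝ) :
      Complex.exp (-(Complex.I * ((P₁ : ℂ) * (k.1 : ℂ) + (P₂ : ℂ) * (k.2 : ℂ)))) *
        f (ofAngles (P₁, P₂)) = e (P₁ / (2 * π), P₂ / (2 * π)) := by
    have h := mFourier_ofAngles (-k) (P₁, P₂)
    have hneg : (![(-k).1, (-k).2] : Fin 2 → ℤ) = -n := by simp [hn]
    rw [hneg] at h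
    change _ = mFourier (-n) (ofAngles (P₁, P₂)) * f (ofAngles (P₁, P₂))
    rw [h]
    congr 2
    simp
    ring
  have hunit : mFourierCoeff f n = ∫ x in (0 : ℝ)..1, ∫ y in (0 : ℝ)..1, e (x, y) := by
    have hset : {x : Fin 2 → ℝ | ∀ i, x i ∈ Set.Ioc ((0 : Fin 2 → ℝ) i) ((0 : Fin 2 → ℝ) i + 1)} =
        MeasurableEquiv.finTwoArrow ⁻¹' (Set.Ioc (0 : ℝ) 1 ×ˢ Set.Ioc (0 : ℝ) 1) := by
      ext x
      simp [Fin.forall_fin_two, MeasurableEquiv.finTwoArrow]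
    rw [mFourierCoeff_eq_integral _ n 0, hset]
    have hint : IntegrableOn e (Set.Ioc (0 : ℝ) 1 ×ˢ Set.Ioc (0 : ℝ) 1)
        ((volume : Measure ℝ).prod volume) :=
      (he.continuousOn.integrableOn_compact (isCompact_Icc.prod isCompact_Icc)).mono_set
        (Set.prod_mono Set.Ioc_subset_Icc_self Set.Ioc_subset_Icc_self)
    have h2 := (volume_preserving_finTwoArrow ℝ).setIntegral_preimage_emb
      MeasurableEquiv.finTwoArrow.measurableEmbedding e (Set.Ioc (0 : ℝ) 1 ×ˢ Set.Ioc (0 : ℝ) 1)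
    simp only [intervalIntegral.integral_of_le zero_le_one]
    rw [← setIntegral_prod e hint]
    refine Eq.trans ?_ h2
    refine integral_congr_ae (.of_forall fun x => ?_)
    have hx : (fun i => (x i : UnitAddCircle)) =
        ![((x 0 : ℝ) : UnitAddCircle), ((x 1 : ℝ) : UnitAddCircle)] := by
      ext i; fin_cases i <;> rfl
    simp only [smul_eq_mul, hx]
    rfl
  have hpi : (2 * π : ℝ) ≠ 0 := two_pi_pos.ne'
  have hpi' : (π : ℂ) ≠ 0 := by exact_mod_cast pi_ne_zero
  simp only [hval]
  have h1 (x : ℝ) : ∫ P₂ in (0 : ℝ)..(2 * π), e (x, P₂ / (2 * π)) =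
      (2 * π) • ∫ y in (0 : ℝ)..1, e (x, y) := by
    rw [intervalIntegral.integral_comp_div (fun y => e (x, y)) hpi, zero_div, div_self hpi]
  simp only [h1]
  rw [intervalIntegral.integral_comp_div (fun x => (2 * π) • ∫ y in (0 : ℝ)..1, e (x, y)) hpi,
    zero_div, div_self hpi, intervalIntegral.integral_smul, ← hunit]
  simp only [real_smul]
  push_cast
  field_simp

end UnitAddTorus

theorem inner_orbit_eq {H : Type*} [NormedAddCommGroup H] [InnerProductSpace ℂ H]
    (T₁ T₂ : H ≃ₗᵢ[ℂ] H) (hcomm : Commute T₁ T₂) (g : H) (a b : ℤ × ℤ) :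
    ⟪(T₁ ^ a.1) ((T₂ ^ a.2) g), (T₁ ^ b.1) ((T₂ ^ b.2) g)⟫ =
      ⟪(T₁ ^ (a - b).1) ((T₂ ^ (a - b).2) g), g⟫ := by
  have h : T₁ ^ a.1 * T₂ ^ a.2 =
      (T₁ ^ b.1 * T₂ ^ b.2) * (T₁ ^ (a - b).1 * T₂ ^ (a - b).2) := by
    rw [mul_assoc, ← mul_assoc (T₂ ^ b.2), ((hcomm.zpow_zpow (a - b).1 b.2).symm).eq, mul_assoc,
      ← mul_assoc, ← zpow_add, ← zpow_add, Prod.fst_sub, Prod.snd_sub, add_sub_cancel,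
      add_sub_cancel]
  change ⟪(T₁ ^ a.1 * T₂ ^ a.2) g, (T₁ ^ b.1 * T₂ ^ b.2) g⟫ = _
  rw [h]
  exact (T₁ ^ b.1 * T₂ ^ b.2).inner_map_map _ g

/-- If the Gram matrix of a family is given by the Fourier coefficients of a function `Φ` on the
torus, then the Gram matrix of the smoothed family `∑ k, c k • x (k + n)` is given by the Fourier
coefficients of `‖G‖² Φ`, where `G` is the sum of the Fourier series with coefficients `c`. -/
theorem inner_tsum_smul_eq_mFourierCoeff {H : Type*} [NormedAddCommGroup H]
    [InnerProductSpace ℂ H] {d : Type*} [Fintype d] {A : Type*} [AddCommGroup A]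
    (v : A →+ d → ℤ) (x : A → H) (Φ G : C(UnitAddTorus d, ℂ)) (c : A → ℂ)
    (hx : ∀ a b, ⟪x a, x b⟫ = mFourierCoeff Φ (v (a - b)))
    (hG : HasSum (fun k => c k • mFourier (v k)) G)
    (Ψ : A → H) (hΨ : ∀ n, HasSum (fun k => c k • x (k + n)) (Ψ n)) (n s : A) :
    ⟪Ψ n, Ψ s⟫ = mFourierCoeff (star G * (G * Φ)) (v (n - s)) := by
  have h₁ (a : A) : ⟪x a, Ψ s⟫ = mFourierCoeff (G * Φ) (v (a - s)) := by
    refine ((innerSL ℂ (x a)).hasSum (hΨ s)).unique ?_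
    convert! hasSum_mFourierCoeff (hG.mul_right Φ) (v (a - s)) using 2 with k
    rw [mFourierCoeff_smul_mFourier_mul, ← map_sub, innerSL_apply_apply, inner_smul_right, hx]
    congr 3
    abel
  have h₂ : HasSum (fun k => conj (c k) * ⟪x (k + n), Ψ s⟫) ⟪Ψ n, Ψ s⟫ := by
    convert! ((innerSL ℂ (Ψ s)).hasSum (hΨ n)).star using 2 with k
    · simp [inner_conj_symm]
    · simp [inner_conj_symm]
  refine h₂.unique ?_
  convert! hasSum_mFourierCoeff (hG.star.mul_right (G * Φ)) (v (n - s)) using 2 with k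
  have hstar : star (c k • mFourier (v k)) = conj (c k) • mFourier (v (-k)) := by
    ext t
    simp [map_neg, mFourier_neg]
  rw [hstar, mFourierCoeff_smul_mFourier_mul, ← map_sub, h₁]
  congr 3
  abel

/-- Pairs of integers as functions on `Fin 2`. -/
def finTwoHom : ℤ × ℤ →+ Fin 2 → ℤ where
  toFun m := ![m.1, m.2]
  map_zero' := by simp
  map_add' m n := by simp

theorem finTwoHom_apply (m : ℤ × ℤ) : finTwoHom m = ![m.1, m.2] := rfl

theorem finTwoHom_bijective : Function.Bijective finTwoHom :=
  (finTwoArrowEquiv ℤ).symm.bijective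

theorem finTwoHom_inj {m n : ℤ × ℤ} : finTwoHom m = finTwoHom n ↔ m = n :=
  finTwoHom_bijective.injective.eq_iff

/-- Orthonormalization for `N = 2`: given commuting unitaries `T₁, T₂` on a complex
Hilbert space `H`, a unit vector `g`, overlap coefficients
`I_m = ⟨T₁^{m₁}T₂^{m₂} g, g⟩` in `ℓ¹(ℤ²)` with `F(P) = Σ_m I_m e^{iP·m}` strictly
positive on `[0,2π)²`, and Fourier coefficients `c_k` of `F^{-1/2}` in `ℓ¹(ℤ²)`,
the vectors `Ψ_n = Σ_k c_k g_{k+n}` form an orthonormal family. -/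
theorem stmt5 {H : Type*} [NormedAddCommGroup H] [InnerProductSpace ℂ H] [CompleteSpace H]
    (T₁ T₂ : H ≃ₗᵢ[ℂ] H) (hcomm : ∀ v : H, T₁ (T₂ v) = T₂ (T₁ v))
    (g : H) (hg : ‖g‖ = 1)
    (gn : ℤ × ℤ → H) (hgn : ∀ n : ℤ × ℤ, gn n = (T₁ ^ n.1) ((T₂ ^ n.2) g))
    (I : ℤ × ℤ → ℂ) (hI : ∀ m : ℤ × ℤ, I m = ⟪gn m, g⟫)
    (hIl1 : Summable fun m : ℤ × ℤ => ‖I m‖)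
    (F : ℝ × ℝ → ℂ)
    (hF : ∀ P : ℝ × ℝ, F P = ∑' m : ℤ × ℤ,
      I m * Complex.exp (Complex.I * ((P.1 : ℂ) * (m.1 : ℂ) + (P.2 : ℂ) * (m.2 : ℂ))))
    (hFpos : ∀ P : ℝ × ℝ, P.1 ∈ Set.Ico (0 : ℝ) (2 * π) → P.2 ∈ Set.Ico (0 : ℝ) (2 * π) →
      0 < (F P).re ∧ (F P).im = 0)
    (c : ℤ × ℤ → ℂ)
    (hc : ∀ k : ℤ × ℤ, c k = ((1 / (2 * π) ^ 2 : ℝ) : ℂ) *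
      ∫ P₁ in (0 : ℝ)..(2 * π), ∫ P₂ in (0 : ℝ)..(2 * π),
        Complex.exp (-(Complex.I * ((P₁ : ℂ) * (k.1 : ℂ) + (P₂ : ℂ) * (k.2 : ℂ)))) /
          ((Real.sqrt ((F (P₁, P₂)).re) : ℝ) : ℂ))
    (hcl1 : Summable fun k : ℤ × ℤ => ‖c k‖)
    (Ψ : ℤ × ℤ → H) (hΨ : ∀ n : ℤ × ℤ, Ψ n = ∑' k : ℤ × ℤ, c k • gn (k + n)) :
    ∀ n s : ℤ × ℤ, ⟪Ψ n, Ψ s⟫ = if n = s then 1 else 0 := by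
  have hgram (a b : ℤ × ℤ) : ⟪gn a, gn b⟫ = I (a - b) := by
    rw [hI, hgn, hgn, hgn, inner_orbit_eq T₁ T₂ (LinearIsometryEquiv.ext hcomm)]
  obtain ⟨Φ, hΦ⟩ : Summable fun m => I m • mFourier (finTwoHom m) :=
    .of_norm (by simpa only [norm_smul, mFourier_norm, mul_one] using hIl1)
  have hΦcoeff (m : ℤ × ℤ) : mFourierCoeff Φ (finTwoHom m) = I m := by
    refine (hasSum_mFourierCoeff hΦ (finTwoHom m)).unique ?_
    convert! hasSum_ite_eq m (I m) using 2 with k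
    have h := mFourierCoeff_smul_mFourier_mul (I k) (finTwoHom k) (finTwoHom m) 1
    rw [mul_one] at h
    rw [h, ← mFourier_zero, mFourierCoeff_mFourier, ← map_sub, ← map_zero finTwoHom]
    simp only [finTwoHom_inj, sub_eq_zero, eq_comm (a := m)]
    split_ifs with hk <;> simp [hk]
  have hFΦ (P : ℝ × ℝ) : F P = Φ (ofAngles P) := by
    rw [hF]
    refine HasSum.tsum_eq ?_
    simpa only [ContinuousMap.evalCLM_apply, ContinuousMap.smul_apply, finTwoHom_apply,
      mFourier_ofAngles, smul_eq_mul] using (ContinuousMap.evalCLM ℂ (ofAngles P)).hasSum hΦ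
  have hΦpos (t : UnitAddTorus (Fin 2)) : 0 < (Φ t).re ∧ (Φ t).im = 0 := by
    obtain ⟨P, h₁, h₂, rfl⟩ := exists_ofAngles_eq t
    rw [← hFΦ]
    exact hFpos P h₁ h₂
  let G : C(UnitAddTorus (Fin 2), ℂ) :=
    ⟨fun t => ((Real.sqrt (Φ t).re : ℝ) : ℂ)⁻¹, by
      refine Continuous.inv₀ (by fun_prop) fun t => ?_
      exact_mod_cast (Real.sqrt_pos.mpr (hΦpos t).1).ne'⟩
  have hGcoeff (k : ℤ × ℤ) : mFourierCoeff G (finTwoHom k) = c k := by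
    rw [finTwoHom_apply, mFourierCoeff_eq_angular_integral, hc]
    simp only [hFΦ, div_eq_mul_inv]
    rfl
  have hG : HasSum (fun k => c k • mFourier (finTwoHom k)) G := by
    let e := Equiv.ofBijective _ finTwoHom_bijective
    have hsum : Summable (mFourierCoeff G) :=
      e.summable_iff.mp (hcl1.of_norm.congr fun k => (hGcoeff k).symm)
    simpa only [Function.comp_def, e, Equiv.ofBijective_apply, hGcoeff] using
      e.hasSum_iff.mpr (hasSum_mFourier_series_of_summable hsum)
  have hGΦ : star G * (G * Φ) = 1 := by
    ext t
    obtain ⟨hre, him⟩ := hΦpos t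
    have hs : ((Real.sqrt (Φ t).re : ℝ) : ℂ) ≠ 0 := by
      exact_mod_cast (Real.sqrt_pos.mpr hre).ne'
    have hΦt : Φ t = ((Real.sqrt (Φ t).re : ℝ) : ℂ) * ((Real.sqrt (Φ t).re : ℝ) : ℂ) := by
      rw [← ofReal_mul, Real.mul_self_sqrt hre.le]
      exact Complex.ext rfl him
    change conj ((Real.sqrt (Φ t).re : ℝ) : ℂ)⁻¹ * (((Real.sqrt (Φ t).re : ℝ) : ℂ)⁻¹ * Φ t) = 1
    rw [map_inv₀, conj_ofReal]
    nth_rewrite 3 [hΦt]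
    field_simp
  have hnorm (m : ℤ × ℤ) : ‖gn m‖ = 1 := by
    rw [hgn, LinearIsometryEquiv.norm_map, LinearIsometryEquiv.norm_map, hg]
  have hΨsum (n : ℤ × ℤ) : HasSum (fun k => c k • gn (k + n)) (Ψ n) := by
    rw [hΨ]
    refine (Summable.of_norm ?_).hasSum
    simpa only [norm_smul, hnorm, mul_one] using hcl1
  intro n s
  rw [inner_tsum_smul_eq_mFourierCoeff finTwoHom gn Φ G c
    (fun a b => by rw [hgram, hΦcoeff]) hG Ψ hΨsum, hGΦ, ← mFourier_zero, mFourierCoeff_mFourier,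
    ← map_zero finTwoHom]
  simp only [finTwoHom_inj, sub_eq_zero]
end

section
/- Let H be a complex Hilbert space, T₁ and T₂ commuting unitary operators on H, g ∈ H with ‖g‖ = 1, g_n = T₁^{n₁}T₂^{n₂}g, and H_g the closed linear span of {g_n : n ∈ ℤ²}. Let I_m = ⟨T₁^{m₁}T₂^{m₂}g, g⟩ with (I_m) ∈ ℓ¹(ℤ²), assume F(P) = Σ_m I_m e^{iP·m} is nonzero for all P ∈ [0,2π)², let c_k be the Fourier coefficients of F^{-1/2}, and assume (c_k) ∈ ℓ¹(ℤ²). Let X = Σ_{m∈ℤ²} c_m T₁^{m₁}T₂^{m₂} (the series converging in operator norm) and Ψ_n = X g_n. Then the family {Ψ_n : n ∈ ℤ²} is complete in H_g (its closed linear span equals H_g) if and only if the restriction of X to H_g admits a bounded inverse on H_g. -/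
open Real Complex

local notation "⟪" x ", " y "⟫" => @inner ℂ _ _ x y

section TorusFourierSeries

open MeasureTheory UnitAddTorus

/-- The Haar measure on `ℝ / ℤ`, normalised to have total mass one. -/
noncomputable local instance instMeasureSpaceUnitAddCircleHaar : MeasureSpace UnitAddCircle :=
  ⟨AddCircle.haarAddCircle⟩

local instance instIsAddHaarMeasureUnitAddCircle :
    Measure.IsAddHaarMeasure (volume : Measure UnitAddCircle) :=
  inferInstanceAs (Measure.IsAddHaarMeasure AddCircle.haarAddCircle)

local instance instIsProbabilityMeasureUnitAddCircle :
    IsProbabilityMeasure (volume : Measure UnitAddCircle) :=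
  inferInstanceAs (IsProbabilityMeasure AddCircle.haarAddCircle)

/-- An absolutely convergent combination of bounded vectors may be regrouped along the fibres
of the map indexing the vectors. -/
lemma hasSum_fiberwise_smul {ι κ E : Type*} [NormedAddCommGroup E] [NormedSpace ℂ E]
    [CompleteSpace E] {ρ : κ → E} (hρ : ∀ k, ‖ρ k‖ ≤ 1) {a : ι → ℂ}
    (ha : Summable fun i => ‖a i‖) (p : ι → κ) :
    HasSum (fun k => (∑' i : p ⁻¹' {k}, a i) • ρ k) (∑' i, a i • ρ (p i)) := by
  have hsum : Summable fun i => a i • ρ (p i) := by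
    refine Summable.of_norm_bounded ha fun i => ?_
    rw [norm_smul]
    exact mul_le_of_le_one_right (norm_nonneg _) (hρ _)
  refine (hsum.hasSum.tsum_fiberwise p).congr_fun fun k => ?_
  have ha' : Summable fun i : p ⁻¹' {k} => a i := (Summable.of_norm ha).subtype _
  rw [← ha'.tsum_smul_const]
  refine tsum_congr fun i => ?_
  rw [show p i = k from i.2]

/-- An absolutely convergent trigonometric series with sum one has coefficients `δ₀`. -/
lemma coeff_eq_of_hasSum_mFourier_one {d : Type*} [Fintype d] [DecidableEq d] {b : (d → ℤ) → ℂ}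
    (h : HasSum (fun k => b k • mFourier k) (1 : C(UnitAddTorus d, ℂ))) (k : d → ℤ) :
    b k = if k = 0 then 1 else 0 := by
  have h2 := (ContinuousMap.toLp (E := ℂ) 2 (volume : Measure (UnitAddTorus d)) ℂ).hasSum h
  have h3 := (innerSL ℂ (mFourierLp (d := d) 2 k)).hasSum h2
  have hort := orthonormal_iff_ite.mp (orthonormal_mFourier (d := d))
  have h1 : ContinuousMap.toLp (E := ℂ) 2 (volume : Measure (UnitAddTorus d)) ℂ 1
      = mFourierLp 2 0 := by
    rw [mFourierLp, mFourier_zero]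
  rw [h1] at h3
  simp only [map_smul, innerSL_apply_apply, smul_eq_mul] at h3
  have h4 : HasSum (fun j => b j * if k = j then (1 : ℂ) else 0) (if k = 0 then 1 else 0) := by
    have := hort k 0
    rw [← this]
    refine h3.congr_fun fun j => ?_
    rw [← hort k j]
  have h5 : HasSum (fun j => b j * if k = j then (1 : ℂ) else 0) (b k) := by
    convert hasSum_single k _ using 1
    · simp
    · intro j hj
      simp [hj.symm]
  exact h5.unique h4

/-- A relation `∑ aᵢ e_{p i} = 1` between characters of the torus passes to any bounded family
indexed by the dual group. -/
lemma tsum_smul_eq_of_tsum_mFourier_eq_one {ι d E : Type*} [Fintype d] [NormedAddCommGroup E]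
    [NormedSpace ℂ E] [CompleteSpace E] {ρ : (d → ℤ) → E} (hρ : ∀ k, ‖ρ k‖ ≤ 1) {a : ι → ℂ}
    (ha : Summable fun i => ‖a i‖) (p : ι → d → ℤ)
    (h : ∑' i, a i • mFourier (p i) = (1 : C(UnitAddTorus d, ℂ))) :
    ∑' i, a i • ρ (p i) = ρ 0 := by
  classical
  have h1 := hasSum_fiberwise_smul (ρ := fun k : d → ℤ => mFourier k)
    (fun k => mFourier_norm.le) ha p
  rw [h] at h1
  have h2 := hasSum_fiberwise_smul hρ ha p
  simp only [coeff_eq_of_hasSum_mFourier_one h1] at h2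
  refine h2.unique ?_
  convert hasSum_single (0 : d → ℤ) _ using 1
  · simp
  · intro j hj
    simp [hj]

/-- The product of three absolutely convergent series along a multiplicative bounded family. -/
lemma tsum_mul_tsum_mul_tsum_smul {κ A : Type*} [AddCommGroup κ] [NormedRing A]
    [NormedAlgebra ℂ A] [CompleteSpace A] {ρ : κ → A} (hρ : ∀ k, ‖ρ k‖ ≤ 1)
    (hadd : ∀ j k, ρ (j + k) = ρ j * ρ k) {a b c : κ → ℂ} (ha : Summable fun i => ‖a i‖)
    (hb : Summable fun i => ‖b i‖) (hc : Summable fun i => ‖c i‖) :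
    (∑' k, a k • ρ k) * ((∑' k, b k • ρ k) * ∑' k, c k • ρ k) =
      ∑' i : κ × κ × κ, (a i.1 * (b i.2.1 * c i.2.2)) • ρ (i.1 + (i.2.1 + i.2.2)) := by
  have key : ∀ {u : κ → ℂ}, (Summable fun i => ‖u i‖) → Summable fun i => ‖u i • ρ i‖ := by
    intro u hu
    refine Summable.of_nonneg_of_le (fun _ => norm_nonneg _) (fun i => ?_) hu
    rw [norm_smul]
    exact mul_le_of_le_one_right (norm_nonneg _) (hρ _)
  rw [tsum_mul_tsum_of_summable_norm (key hb) (key hc),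
    tsum_mul_tsum_of_summable_norm (key ha) ((key hb).mul_norm (key hc))]
  refine tsum_congr fun i => ?_
  simp only [hadd, smul_mul_smul_comm]

/-- A multiplicative relation `f · (g · h) = 1` between absolutely convergent trigonometric series
holds for the same series along any bounded multiplicative family. -/
lemma tsum_mul_tsum_mul_tsum_eq_one {d A : Type*} [Fintype d] [NormedRing A]
    [NormedAlgebra ℂ A] [CompleteSpace A] {ρ : (d → ℤ) → A} (hρ : ∀ k, ‖ρ k‖ ≤ 1)
    (hadd : ∀ j k, ρ (j + k) = ρ j * ρ k) (hzero : ρ 0 = 1) {a b c : (d → ℤ) → ℂ}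
    (ha : Summable fun i => ‖a i‖) (hb : Summable fun i => ‖b i‖) (hc : Summable fun i => ‖c i‖)
    (h : (∑' k, a k • mFourier k) * ((∑' k, b k • mFourier k) * ∑' k, c k • mFourier k) =
      (1 : C(UnitAddTorus d, ℂ))) :
    (∑' k, a k • ρ k) * ((∑' k, b k • ρ k) * ∑' k, c k • ρ k) = 1 := by
  rw [tsum_mul_tsum_mul_tsum_smul (ρ := fun k : d → ℤ => mFourier k)
    (fun k => mFourier_norm.le) (fun j k => by ext x; exact mFourier_add) ha hb hc] at h
  rw [tsum_mul_tsum_mul_tsum_smul hρ hadd ha hb hc, ← hzero]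
  refine tsum_smul_eq_of_tsum_mFourier_eq_one hρ ?_ _ h
  exact ha.mul_norm (g := fun i : (d → ℤ) × (d → ℤ) => b i.1 * c i.2) (hb.mul_norm hc)

/-- A square-integrable function with absolutely summable Fourier coefficients agrees almost
everywhere with the sum of its Fourier series. -/
lemma ae_eq_tsum_mFourier {d : Type*} [Fintype d] {G : UnitAddTorus d → ℂ} (hG : MemLp G 2)
    (hs : Summable fun k => ‖mFourierCoeff G k‖) :
    G =ᵐ[volume] (∑' k, mFourierCoeff G k • mFourier k : C(UnitAddTorus d, ℂ)) := by
  have hsum : Summable fun k => mFourierCoeff G k • (mFourier k : C(UnitAddTorus d, ℂ)) := by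
    refine Summable.of_norm ?_
    simpa only [norm_smul, mFourier_norm, mul_one] using hs
  have h1 := (ContinuousMap.toLp (E := ℂ) 2 (volume : Measure (UnitAddTorus d)) ℂ).hasSum
    hsum.hasSum
  have h2 := hasSum_mFourier_series_L2 (hG.toLp G)
  have hcoeff : ∀ k, mFourierCoeff (hG.toLp G) k = mFourierCoeff G k := fun k =>
    integral_congr_ae (ae_eq_rfl.mul hG.coeFn_toLp)
  simp only [hcoeff] at h2
  simp only [map_smul] at h1
  have h3 := h2.unique h1
  have h4 := hG.coeFn_toLp
  rw [h3] at h4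
  exact h4.symm.trans (ContinuousMap.coeFn_toLp volume _)

/-- Integration over the unit circle as integration over `[0, 1]`. -/
lemma integral_unitAddCircle_eq_intervalIntegral (φ : UnitAddCircle → ℂ) :
    ∫ t, φ t = ∫ x in (0 : ℝ)..1, φ x := by
  have h := AddCircle.intervalIntegral_preimage 1 0 φ
  rw [zero_add, AddCircle.volume_eq_smul_haarAddCircle, ENNReal.ofReal_one, one_smul] at h
  exact h.symm

/-- Integration over the two-dimensional torus as an iterated integral. -/
lemma integral_torus_fin_two {h : UnitAddTorus (Fin 2) → ℂ} (hh : Integrable h) :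
    ∫ t, h t = ∫ x in (0 : ℝ)..1, ∫ y in (0 : ℝ)..1,
      h ![(x : UnitAddCircle), (y : UnitAddCircle)] := by
  have hmp := (volume_preserving_finTwoArrow UnitAddCircle).symm
  have hemb := (MeasurableEquiv.finTwoArrow (α := UnitAddCircle)).symm.measurableEmbedding
  rw [← hmp.integral_comp hemb]
  have hint := (hmp.integrable_comp_emb hemb).mpr hh
  rw [Measure.volume_eq_prod] at hint ⊢
  rw [integral_prod (fun z => h (MeasurableEquiv.finTwoArrow.symm z)) hint,
    integral_unitAddCircle_eq_intervalIntegral]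
  refine intervalIntegral.integral_congr fun x _ => ?_
  exact integral_unitAddCircle_eq_intervalIntegral _

lemma mFourier_fin_two_apply (k : Fin 2 → ℤ) (x y : ℝ) :
    mFourier k ![(x : UnitAddCircle), (y : UnitAddCircle)] =
      Complex.exp (Complex.I * (((2 * π * x : ℝ) : ℂ) * (k 0 : ℂ) +
        ((2 * π * y : ℝ) : ℂ) * (k 1 : ℂ))) := by
  simp only [mFourier, ContinuousMap.coe_mk, Fin.prod_univ_two, Matrix.cons_val_zero,
    Matrix.cons_val_one, fourier_coe_apply, ← Complex.exp_add]
  congr 1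
  push_cast
  ring

/-- Fourier coefficients on the two-dimensional torus as iterated integrals over `[0, 2π]²`. -/
lemma mFourierCoeff_fin_two {G : UnitAddTorus (Fin 2) → ℂ} (hG : Integrable G) (k : Fin 2 → ℤ)
    (f : ℝ → ℝ → ℂ)
    (hf : ∀ x y : ℝ, f (2 * π * x) (2 * π * y) = G ![(x : UnitAddCircle), (y : UnitAddCircle)]) :
    mFourierCoeff G k = ((1 / (2 * π) ^ 2 : ℝ) : ℂ) *
      ∫ x in (0 : ℝ)..(2 * π), ∫ y in (0 : ℝ)..(2 * π),
        Complex.exp (-(Complex.I * ((x : ℂ) * (k 0 : ℂ) + (y : ℂ) * (k 1 : ℂ)))) * f x y := by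
  simp only [mFourierCoeff, smul_eq_mul]
  rw [integral_torus_fin_two (hG.bdd_mul (c := 1)
    (mFourier (-k)).continuous.aestronglyMeasurable
    (.of_forall fun t => ((mFourier (-k)).norm_coe_le_norm t).trans mFourier_norm.le))]
  have hπ : (2 * π) ≠ 0 := by positivity
  let φ : ℝ → ℝ → ℂ := fun x y =>
    Complex.exp (-(Complex.I * ((x : ℂ) * (k 0 : ℂ) + (y : ℂ) * (k 1 : ℂ)))) * f x y
  have hinner : ∀ x : ℝ, ∫ y in (0 : ℝ)..1,
      mFourier (-k) ![(x : UnitAddCircle), (y : UnitAddCircle)] *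
        G ![(x : UnitAddCircle), (y : UnitAddCircle)] =
      (2 * π)⁻¹ • ∫ y in (0 : ℝ)..(2 * π), φ (2 * π * x) y := by
    intro x
    have hscale := intervalIntegral.integral_comp_mul_left (a := 0) (b := 1) (φ (2 * π * x)) hπ
    rw [mul_zero, mul_one] at hscale
    rw [← hscale]
    refine intervalIntegral.integral_congr fun y _ => ?_
    simp only [φ, mFourier_fin_two_apply, hf, Pi.neg_apply, Int.cast_neg]
    congr 2
    ring
  simp only [hinner]
  rw [intervalIntegral.integral_comp_mul_left
    (fun x : ℝ => (2 * π)⁻¹ • ∫ y in (0 : ℝ)..(2 * π), φ x y) hπ]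
  rw [mul_zero, mul_one, intervalIntegral.integral_smul, smul_smul, Complex.real_smul,
    show (2 * π)⁻¹ * (2 * π)⁻¹ = 1 / (2 * π) ^ 2 by field_simp]

/-- Inverting a nonvanishing continuous function on the torus through the Fourier series of a
(measurable) inverse square root. -/
lemma tsum_mFourierCoeff_cpow_neg_half_sq_mul {d : Type*} [Fintype d]
    {Φ : C(UnitAddTorus d, ℂ)} (hne : ∀ t, Φ t ≠ 0) {a : (d → ℤ) → ℂ}
    (ha : Summable fun k => ‖a k‖)
    (hcoeff : ∀ k, mFourierCoeff (fun t => Φ t ^ (-(1 / 2 : ℂ))) k = a k)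
    (hG : MemLp (fun t => Φ t ^ (-(1 / 2 : ℂ))) 2) :
    (∑' k, a k • mFourier k) * ((∑' k, a k • mFourier k) * Φ) = (1 : C(UnitAddTorus d, ℂ)) := by
  have hae := ae_eq_tsum_mFourier hG (by simpa only [hcoeff] using ha)
  simp only [hcoeff] at hae
  have hone : ⇑((∑' k, a k • mFourier k) * ((∑' k, a k • mFourier k) * Φ)) =ᵐ[volume]
      ⇑(1 : C(UnitAddTorus d, ℂ)) := by
    filter_upwards [hae] with t ht
    rw [ContinuousMap.mul_apply, ContinuousMap.mul_apply, ← ht, ContinuousMap.one_apply,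
      ← mul_assoc, ← Complex.cpow_add _ _ (hne t),
      show (-(1 / 2 : ℂ)) + -(1 / 2 : ℂ) = -1 by norm_num, Complex.cpow_neg_one,
      inv_mul_cancel₀ (hne t)]
  exact DFunLike.coe_injective
    ((Continuous.ae_eq_iff_eq volume (map_continuous _) (map_continuous _)).mp hone)

lemma memLp_cpow_neg_half {d : Type*} [Fintype d] {Φ : C(UnitAddTorus d, ℂ)}
    (hne : ∀ t, Φ t ≠ 0) (p : ENNReal) : MemLp (fun t => Φ t ^ (-(1 / 2 : ℂ))) p := by
  have hcont : Continuous fun t => ‖Φ t‖ ^ (-(1 / 2) : ℝ) :=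
    Continuous.rpow_const (by fun_prop) fun t => Or.inl (norm_ne_zero_iff.mpr (hne t))
  obtain ⟨C, hC⟩ := isCompact_univ.exists_bound_of_continuousOn hcont.continuousOn
  refine MemLp.of_bound (Φ.continuous.measurable.pow_const _).aestronglyMeasurable C
    (.of_forall fun t => ?_)
  rw [show (-(1 / 2 : ℂ)) = ((-(1 / 2) : ℝ) : ℂ) by push_cast; rfl, Complex.norm_cpow_real]
  exact (Real.le_norm_self _).trans (hC t (Set.mem_univ t))

/-- The Fourier coefficients `c` of `F ^ (-1/2)` and the coefficients `J` of `F` satisfy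
`c * c * J = δ₀`, expressed along any bounded multiplicative family. -/
lemma tsum_coeff_invSqrt_sq_mul_eq_one {A : Type*} [NormedRing A] [NormedAlgebra ℂ A]
    [CompleteSpace A] {ρ : ℤ × ℤ → A} (hρ : ∀ k, ‖ρ k‖ ≤ 1)
    (hadd : ∀ j k, ρ (j + k) = ρ j * ρ k) (hzero : ρ 0 = 1) {J : ℤ × ℤ → ℂ}
    (hJ : Summable fun m => ‖J m‖) {F : ℝ × ℝ → ℂ}
    (hF : ∀ P : ℝ × ℝ, F P = ∑' m : ℤ × ℤ,
      J m * Complex.exp (Complex.I * ((P.1 : ℂ) * (m.1 : ℂ) + (P.2 : ℂ) * (m.2 : ℂ))))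
    (hFne : ∀ P : ℝ × ℝ, P.1 ∈ Set.Ico (0 : ℝ) (2 * π) → P.2 ∈ Set.Ico (0 : ℝ) (2 * π) →
      F P ≠ 0)
    {c : ℤ × ℤ → ℂ}
    (hc : ∀ k : ℤ × ℤ, c k = ((1 / (2 * π) ^ 2 : ℝ) : ℂ) *
      ∫ P₁ in (0 : ℝ)..(2 * π), ∫ P₂ in (0 : ℝ)..(2 * π),
        Complex.exp (-(Complex.I * ((P₁ : ℂ) * (k.1 : ℂ) + (P₂ : ℂ) * (k.2 : ℂ)))) *
          (F (P₁, P₂)) ^ (-(1 / 2 : ℂ)))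
    (hcl1 : Summable fun k => ‖c k‖) :
    (∑' k, c k • ρ k) * ((∑' k, c k • ρ k) * ∑' k, J k • ρ k) = 1 := by
  let e : (Fin 2 → ℤ) ≃ ℤ × ℤ := finTwoArrowEquiv ℤ
  have hJe : Summable fun k => ‖J (e k)‖ := e.summable_iff.mpr hJ
  have hce : Summable fun k => ‖c (e k)‖ := e.summable_iff.mpr hcl1
  have hΦs : Summable fun k => J (e k) • (mFourier k : C(UnitAddTorus (Fin 2), ℂ)) := by
    refine Summable.of_norm ?_
    simpa only [norm_smul, mFourier_norm, mul_one] using hJe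
  let Φ : C(UnitAddTorus (Fin 2), ℂ) := ∑' k, J (e k) • mFourier k
  have hΦF : ∀ x y : ℝ, F (2 * π * x, 2 * π * y) =
      Φ ![(x : UnitAddCircle), (y : UnitAddCircle)] := by
    intro x y
    rw [hF, ← e.tsum_eq]
    refine Eq.trans (tsum_congr fun k => ?_) (ContinuousMap.tsum_apply hΦs _)
    rw [ContinuousMap.smul_apply, mFourier_fin_two_apply]
    rfl
  have hne : ∀ t, Φ t ≠ 0 := by
    intro t
    obtain ⟨x, hx, hxt⟩ := AddCircle.eq_coe_Ico (t 0)
    obtain ⟨y, hy, hyt⟩ := AddCircle.eq_coe_Ico (t 1)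
    have hscale : ∀ {z : ℝ}, z ∈ Set.Ico (0 : ℝ) 1 → 2 * π * z ∈ Set.Ico (0 : ℝ) (2 * π) :=
      fun hz => ⟨mul_nonneg (by positivity) hz.1, mul_lt_of_lt_one_right (by positivity) hz.2⟩
    have ht : t = ![(x : UnitAddCircle), (y : UnitAddCircle)] := by
      ext i
      fin_cases i
      · exact hxt.symm
      · exact hyt.symm
    rw [ht, ← hΦF]
    exact hFne _ (hscale hx) (hscale hy)
  have hG := memLp_cpow_neg_half hne 2
  have hcoeff : ∀ k, mFourierCoeff (fun t => Φ t ^ (-(1 / 2 : ℂ))) k = c (e k) := by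
    intro k
    rw [hc, mFourierCoeff_fin_two (hG.integrable one_le_two) k
      (fun x y => F (x, y) ^ (-(1 / 2 : ℂ))) fun x y => by rw [hΦF]]
    rfl
  have key := tsum_mul_tsum_mul_tsum_eq_one (ρ := fun k => ρ (e k)) (fun k => hρ _)
    (fun j k => hadd (e j) (e k)) hzero hce hce hJe
    (tsum_mFourierCoeff_cpow_neg_half_sq_mul hne hce hcoeff hG)
  rwa [e.tsum_eq fun k => c k • ρ k, e.tsum_eq fun k => J k • ρ k] at key

end TorusFourierSeries

/-- A norm-convergent series of operators preserving a closed subspace preserves it as well. -/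
lemma tsum_smul_apply_mem {ι H : Type*} [NormedAddCommGroup H] [NormedSpace ℂ H]
    {K : Submodule ℂ H} (hK : IsClosed (K : Set H)) {ρ : ι → H →L[ℂ] H} {a : ι → ℂ}
    (hs : Summable fun i => a i • ρ i) (hρ : ∀ i, ∀ v ∈ K, ρ i v ∈ K) {v : H} (hv : v ∈ K) :
    (∑' i, a i • ρ i) v ∈ K :=
  hK.mem_of_tendsto (hs.hasSum.mapL (ContinuousLinearMap.apply ℂ H v))
    (.of_forall fun _ => K.sum_mem fun i _ => K.smul_mem _ (hρ i v hv))

/-- Let `T₁, T₂` be commuting unitaries on a complex Hilbert space `H`, `g` a unit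
vector, `g_n = T₁^{n₁}T₂^{n₂} g`, and `H_g` the closed span of the `g_n`.  With
`I_m = ⟨T₁^{m₁}T₂^{m₂} g, g⟩ ∈ ℓ¹(ℤ²)`, `F(P) = Σ_m I_m e^{iP·m}` nonvanishing on
`[0,2π)²`, `c_k` the Fourier coefficients of `F^{-1/2}` assumed in `ℓ¹(ℤ²)`,
`X = Σ_m c_m T₁^{m₁}T₂^{m₂}` and `Ψ_n = X g_n`, the family `{Ψ_n}` is complete in
`H_g` if and only if the restriction of `X` to `H_g` admits a bounded inverse on
`H_g`. -/
theorem stmt9 {H : Type*} [NormedAddCommGroup H] [InnerProductSpace ℂ H] [CompleteSpace H]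
    (T₁ T₂ : H ≃ₗᵢ[ℂ] H) (hcomm : ∀ v : H, T₁ (T₂ v) = T₂ (T₁ v))
    (g : H) (hg : ‖g‖ = 1)
    (gn : ℤ × ℤ → H) (hgn : ∀ n : ℤ × ℤ, gn n = (T₁ ^ n.1) ((T₂ ^ n.2) g))
    (Hg : Submodule ℂ H) (hHg : Hg = (Submodule.span ℂ (Set.range gn)).topologicalClosure)
    (I : ℤ × ℤ → ℂ) (hI : ∀ m : ℤ × ℤ, I m = ⟪gn m, g⟫)
    (hIl1 : Summable fun m : ℤ × ℤ => ‖I m‖)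
    (F : ℝ × ℝ → ℂ)
    (hF : ∀ P : ℝ × ℝ, F P = ∑' m : ℤ × ℤ,
      I m * Complex.exp (Complex.I * ((P.1 : ℂ) * (m.1 : ℂ) + (P.2 : ℂ) * (m.2 : ℂ))))
    (hFne : ∀ P : ℝ × ℝ, P.1 ∈ Set.Ico (0 : ℝ) (2 * π) → P.2 ∈ Set.Ico (0 : ℝ) (2 * π) →
      F P ≠ 0)
    (c : ℤ × ℤ → ℂ)
    (hc : ∀ k : ℤ × ℤ, c k = ((1 / (2 * π) ^ 2 : ℝ) : ℂ) *
      ∫ P₁ in (0 : ℝ)..(2 * π), ∫ P₂ in (0 : ℝ)..(2 * π),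
        Complex.exp (-(Complex.I * ((P₁ : ℂ) * (k.1 : ℂ) + (P₂ : ℂ) * (k.2 : ℂ)))) *
          (F (P₁, P₂)) ^ (-(1 / 2 : ℂ)))
    (hcl1 : Summable fun k : ℤ × ℤ => ‖c k‖)
    (X : H →L[ℂ] H)
    (hX : X = ∑' m : ℤ × ℤ,
      c m • ((T₂ ^ m.2).trans (T₁ ^ m.1)).toLinearIsometry.toContinuousLinearMap)
    (Ψ : ℤ × ℤ → H) (hΨ : ∀ n : ℤ × ℤ, Ψ n = X (gn n)) :
    (Submodule.span ℂ (Set.range Ψ)).topologicalClosure = Hg ↔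
      ∃ Y : H →L[ℂ] H, (∀ v ∈ Hg, Y v ∈ Hg) ∧
        ∀ v ∈ Hg, Y (X v) = v ∧ X (Y v) = v := by
  let ρ : ℤ × ℤ → H →L[ℂ] H := fun m =>
    ((T₂ ^ m.2).trans (T₁ ^ m.1)).toLinearIsometry.toContinuousLinearMap
  have hT : Commute T₁ T₂ := LinearIsometryEquiv.ext hcomm
  have hρ : ∀ k, ‖ρ k‖ ≤ 1 := fun k => LinearIsometry.norm_toContinuousLinearMap_le _
  have hmul : ∀ j k : ℤ × ℤ, T₁ ^ (j + k).1 * T₂ ^ (j + k).2 =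
      T₁ ^ j.1 * T₂ ^ j.2 * (T₁ ^ k.1 * T₂ ^ k.2) := fun j k => by
    rw [Prod.fst_add, Prod.snd_add, zpow_add, zpow_add, mul_assoc, mul_assoc,
      ((hT.zpow_zpow k.1 j.2).left_comm _)]
  have hadd : ∀ j k, ρ (j + k) = ρ j * ρ k := fun j k =>
    ContinuousLinearMap.ext fun v => DFunLike.congr_fun (hmul j k) v
  have hzero : ρ 0 = 1 := rfl
  have hρcomm : ∀ j k, Commute (ρ j) (ρ k) := fun j k => by
    rw [Commute, SemiconjBy, ← hadd, ← hadd, add_comm]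
  have hsum : ∀ {a : ℤ × ℤ → ℂ}, (Summable fun m => ‖a m‖) → Summable fun m => a m • ρ m := by
    intro a ha
    refine Summable.of_norm_bounded ha fun m => ?_
    rw [norm_smul]
    exact mul_le_of_le_one_right (norm_nonneg _) (hρ m)
  have hgρ : ∀ n, gn n = ρ n g := hgn
  have hclosed : IsClosed (Hg : Set H) := hHg ▸ Submodule.isClosed_topologicalClosure _
  have hle : ∀ {K : Submodule ℂ H}, IsClosed (K : Set H) → (∀ n, gn n ∈ K) → Hg ≤ K := by
    intro K hK hn
    rw [hHg]
    exact Submodule.topologicalClosure_minimal _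
      (Submodule.span_le.mpr (Set.range_subset_iff.mpr hn)) hK
  have hgmem : ∀ n, gn n ∈ Hg := fun n => by
    rw [hHg]
    exact Submodule.le_topologicalClosure _ (Submodule.subset_span ⟨n, rfl⟩)
  have hρmem : ∀ m, ∀ v ∈ Hg, ρ m v ∈ Hg := by
    intro m
    refine hle (K := Hg.comap (ρ m).toLinearMap) (hclosed.preimage (ρ m).continuous) fun n => ?_
    have hshift : ρ m (gn n) = gn (m + n) := by
      rw [hgρ, hgρ, hadd]
      rfl
    rw [Submodule.mem_comap]
    exact hshift.symm ▸ hgmem (m + n)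
  have hXmem : ∀ v ∈ Hg, X v ∈ Hg := fun v hv => by
    rw [hX]
    exact tsum_smul_apply_mem hclosed (hsum hcl1) hρmem hv
  constructor
  · rintro -
    let A : H →L[ℂ] H := ∑' m, I m • ρ m
    have hAmem : ∀ v ∈ Hg, A v ∈ Hg := fun v hv =>
      tsum_smul_apply_mem hclosed (hsum hIl1) hρmem hv
    have hXA : X * (X * A) = 1 := by
      rw [hX]
      exact tsum_coeff_invSqrt_sq_mul_eq_one hρ hadd hzero hIl1 hF hFne hc hcl1
    have hcommXA : Commute X (X * A) := by
      refine (Commute.refl X).mul_right ?_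
      rw [hX]
      exact Commute.tsum_left _ fun i => Commute.tsum_right _ fun j =>
        ((hρcomm i j).smul_left _).smul_right _
    refine ⟨X * A, fun v hv => hXmem _ (hAmem v hv), fun v _ => ⟨?_, ?_⟩⟩
    · exact DFunLike.congr_fun (hcommXA.eq.symm.trans hXA) v
    · exact DFunLike.congr_fun hXA v
  · rintro ⟨Y, hYmem, hY⟩
    refine le_antisymm (Submodule.topologicalClosure_minimal _ (Submodule.span_le.mpr
      (Set.range_subset_iff.mpr fun n => hΨ n ▸ hXmem _ (hgmem n))) hclosed) fun v hv => ?_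
    rw [← (hY v hv).2]
    refine hle (K := (Submodule.span ℂ (Set.range Ψ)).topologicalClosure.comap X.toLinearMap)
      ((Submodule.isClosed_topologicalClosure _).preimage X.continuous) (fun n => ?_)
      (hYmem v hv)
    exact Submodule.le_topologicalClosure _ (Submodule.subset_span ⟨n, hΨ n⟩)
end

section
/- Let 1 < a < 2 and for n ∈ ℤ let g_n = χ_{[n, n+a)} ∈ L²(ℝ) be the characteristic function of the interval [n, n+a). Then the family {g_n}_{n∈ℤ} is a (2−a, 3a−2)-frame for its closed linear span V: for every f ∈ V, (2−a)‖f‖² ≤ Σ_{n∈ℤ} |⟨f, g_n⟩|² ≤ (3a−2)‖f‖². -/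
open MeasureTheory Real Complex ComplexConjugate

section Gram

variable {ι E : Type*} [NormedAddCommGroup E] [InnerProductSpace ℂ E]

/-- A Schur-test estimate: if all `v i` have squared norm `a` and the off-diagonal rows of the
Gram matrix have absolute sums at most `r`, then the Gram form differs from `a` times the
`ℓ²`-norm squared by at most `r` times the `ℓ²`-norm squared. -/
lemma abs_norm_sq_sum_smul_sub_le [DecidableEq ι] {v : ι → E} {a r : ℝ}
    (hdiag : ∀ i, ‖v i‖ ^ 2 = a)
    (hrow : ∀ (s : Finset ι) (i : ι), ∑ j ∈ s.erase i, ‖inner ℂ (v i) (v j)‖ ≤ r)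
    (s : Finset ι) (c : ι → ℂ) :
    |‖∑ i ∈ s, c i • v i‖ ^ 2 - a * ∑ i ∈ s, ‖c i‖ ^ 2| ≤ r * ∑ i ∈ s, ‖c i‖ ^ 2 := by
  set K : ι → ι → ℝ := fun i j => if i = j then 0 else ‖inner ℂ (v i) (v j)‖ with hK
  have hKsymm : ∀ i j, K i j = K j i := fun i j => by
    simp only [hK, eq_comm (a := i) (b := j), norm_inner_symm (v i) (v j)]
  have hKrow : ∀ i ∈ s, ∑ j ∈ s, K i j ≤ r := fun i hi => by
    refine le_trans (le_of_eq ?_) (hrow s i)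
    rw [← Finset.add_sum_erase s _ hi]
    simp only [hK, if_true, zero_add]
    exact Finset.sum_congr rfl fun j hj => if_neg (Finset.ne_of_mem_erase hj).symm
  have hexp : ‖∑ i ∈ s, c i • v i‖ ^ 2 - a * ∑ i ∈ s, ‖c i‖ ^ 2 =
      ∑ i ∈ s, ∑ j ∈ s,
        ((inner ℂ (c i • v i) (c j • v j)).re - if i = j then a * ‖c i‖ ^ 2 else 0) := by
    have h := inner_self_eq_norm_sq (𝕜 := ℂ) (∑ i ∈ s, c i • v i)
    simp only [RCLike.re_to_complex] at h
    rw [← h, sum_inner]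
    simp only [inner_sum, Finset.sum_sub_distrib, Complex.re_sum, Finset.mul_sum]
    congr 1
    exact Finset.sum_congr rfl fun i hi => by simp [hi]
  have hterm : ∀ i j, |(inner ℂ (c i • v i) (c j • v j)).re -
      if i = j then a * ‖c i‖ ^ 2 else 0| ≤ K i j * ((‖c i‖ ^ 2 + ‖c j‖ ^ 2) / 2) := by
    intro i j
    by_cases hij : i = j
    · subst hij
      have h := inner_self_eq_norm_sq (𝕜 := ℂ) (c i • v i)
      simp only [RCLike.re_to_complex] at h
      rw [h, norm_smul, mul_pow, hdiag]
      simp [hK, mul_comm]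
    · simp only [hK, if_neg hij, sub_zero]
      refine (Complex.abs_re_le_norm _).trans ?_
      rw [inner_smul_left, inner_smul_right, norm_mul, norm_mul, RCLike.norm_conj]
      nlinarith [mul_nonneg (norm_nonneg (inner ℂ (v i) (v j))) (sq_nonneg (‖c i‖ - ‖c j‖))]
  rw [hexp]
  calc _ ≤ ∑ i ∈ s, ∑ j ∈ s, K i j * ((‖c i‖ ^ 2 + ‖c j‖ ^ 2) / 2) :=
        (Finset.abs_sum_le_sum_abs _ _).trans <| Finset.sum_le_sum fun i _ =>
          (Finset.abs_sum_le_sum_abs _ _).trans <| Finset.sum_le_sum fun j _ => hterm i j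
    _ = (∑ i ∈ s, ∑ j ∈ s, K i j * ‖c i‖ ^ 2) / 2 +
          (∑ i ∈ s, ∑ j ∈ s, K i j * ‖c j‖ ^ 2) / 2 := by
        simp only [Finset.sum_div, ← Finset.sum_add_distrib]
        exact Finset.sum_congr rfl fun i _ => Finset.sum_congr rfl fun j _ => by ring
    _ = ∑ i ∈ s, ∑ j ∈ s, K i j * ‖c i‖ ^ 2 := by
        have : ∑ i ∈ s, ∑ j ∈ s, K i j * ‖c j‖ ^ 2 = ∑ i ∈ s, ∑ j ∈ s, K i j * ‖c i‖ ^ 2 := by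
          rw [Finset.sum_comm]
          exact Finset.sum_congr rfl fun i _ => Finset.sum_congr rfl fun j _ => by rw [hKsymm]
        rw [this]; ring
    _ ≤ r * ∑ i ∈ s, ‖c i‖ ^ 2 := by
        rw [Finset.mul_sum]
        refine Finset.sum_le_sum fun i hi => ?_
        rw [← Finset.sum_mul]
        exact mul_le_mul_of_nonneg_right (hKrow i hi) (sq_nonneg _)

/-- The upper Riesz bound for finite combinations implies the Bessel bound. -/
lemma sum_norm_inner_sq_le_of_norm_sq_sum_smul_le {v : ι → E} {B : ℝ} (hB0 : 0 ≤ B)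
    (hB : ∀ (s : Finset ι) (c : ι → ℂ),
      ‖∑ i ∈ s, c i • v i‖ ^ 2 ≤ B * ∑ i ∈ s, ‖c i‖ ^ 2)
    (f : E) (s : Finset ι) : ∑ i ∈ s, ‖inner ℂ (v i) f‖ ^ 2 ≤ B * ‖f‖ ^ 2 := by
  set S := ∑ i ∈ s, ‖inner ℂ (v i) f‖ ^ 2 with hS
  set w := ∑ i ∈ s, inner ℂ (v i) f • v i with hw
  have hS0 : 0 ≤ S := Finset.sum_nonneg fun i _ => sq_nonneg _
  have hin : ‖inner ℂ w f‖ = S := by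
    have : inner ℂ w f = (S : ℂ) := by
      rw [hw, sum_inner, hS]
      push_cast
      refine Finset.sum_congr rfl fun i _ => ?_
      rw [inner_smul_left, mul_comm, Complex.mul_conj, Complex.normSq_eq_norm_sq]
      push_cast; rfl
    rw [this, Complex.norm_real, Real.norm_of_nonneg hS0]
  have h1 : S ≤ ‖w‖ * ‖f‖ := hin ▸ norm_inner_le_norm w f
  have h2 : ‖w‖ ^ 2 ≤ B * S := hB s _
  rcases hS0.eq_or_lt with h0 | h0
  · rw [← h0]; positivity
  · have h3 : S ^ 2 ≤ (B * S) * ‖f‖ ^ 2 := by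
      calc S ^ 2 ≤ (‖w‖ * ‖f‖) ^ 2 := by gcongr
        _ = ‖w‖ ^ 2 * ‖f‖ ^ 2 := by ring
        _ ≤ _ := by gcongr
    nlinarith

/-- The lower Riesz bound for finite combinations implies the lower frame bound on the closed
span, provided the frame coefficients are square summable. -/
lemma mul_norm_sq_le_tsum_norm_inner_sq {v : ι → E} {A : ℝ}
    (hA : ∀ (s : Finset ι) (c : ι → ℂ),
      A * ∑ i ∈ s, ‖c i‖ ^ 2 ≤ ‖∑ i ∈ s, c i • v i‖ ^ 2)
    {f : E} (hsum : Summable fun i => ‖inner ℂ (v i) f‖ ^ 2)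
    (hf : f ∈ (Submodule.span ℂ (Set.range v)).topologicalClosure) :
    A * ‖f‖ ^ 2 ≤ ∑' i, ‖inner ℂ (v i) f‖ ^ 2 := by
  set N := ∑' i, ‖inner ℂ (v i) f‖ ^ 2 with hN
  have hN0 : 0 ≤ N := tsum_nonneg fun i => sq_nonneg _
  rcases le_total A 0 with hA0 | hA0
  · exact (mul_nonpos_of_nonpos_of_nonneg hA0 (sq_nonneg _)).trans hN0
  have hspan : ∀ h ∈ Submodule.span ℂ (Set.range v), A * ‖inner ℂ h f‖ ^ 2 ≤ ‖h‖ ^ 2 * N := by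
    intro h hh
    obtain ⟨c, rfl⟩ := (Finsupp.mem_span_range_iff_exists_finsupp).1 hh
    simp only [Finsupp.sum]
    have h1 : ‖inner ℂ (∑ i ∈ c.support, c i • v i) f‖ ≤
        ∑ i ∈ c.support, ‖c i‖ * ‖inner ℂ (v i) f‖ := by
      rw [sum_inner]
      refine (norm_sum_le _ _).trans (le_of_eq (Finset.sum_congr rfl fun i _ => ?_))
      rw [inner_smul_left, norm_mul, RCLike.norm_conj]
    calc A * ‖inner ℂ (∑ i ∈ c.support, c i • v i) f‖ ^ 2
        ≤ A * ((∑ i ∈ c.support, ‖c i‖ ^ 2) * ∑ i ∈ c.support, ‖inner ℂ (v i) f‖ ^ 2) := by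
          gcongr
          exact (pow_le_pow_left₀ (norm_nonneg _) h1 2).trans
            (Finset.sum_mul_sq_le_sq_mul_sq _ _ _)
      _ = (A * ∑ i ∈ c.support, ‖c i‖ ^ 2) * ∑ i ∈ c.support, ‖inner ℂ (v i) f‖ ^ 2 := by ring
      _ ≤ _ := by
          refine mul_le_mul (hA _ _) (hsum.sum_le_tsum _ fun i _ => sq_nonneg _)
            (Finset.sum_nonneg fun i _ => sq_nonneg _) (sq_nonneg _)
  have hclosed : IsClosed {h : E | A * ‖inner ℂ h f‖ ^ 2 ≤ ‖h‖ ^ 2 * N} :=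
    isClosed_le (by fun_prop) (by fun_prop)
  have hff : A * ‖inner ℂ f f‖ ^ 2 ≤ ‖f‖ ^ 2 * N :=
    closure_minimal (fun h hh => hspan h hh) hclosed hf
  rw [inner_self_eq_norm_sq_to_K] at hff
  rcases (norm_nonneg f).eq_or_lt with h0 | h0
  · simpa [← h0] using hN0
  · have : 0 < ‖f‖ ^ 2 := by positivity
    simp only [norm_pow, RCLike.norm_ofReal, abs_norm] at hff
    nlinarith

end Gram

/-- The function `χ_{[n, n+a)}` as an element of `L²(ℝ)`. -/
noncomputable def translatedIndicator (a : ℝ) (n : ℤ) : Lp ℂ 2 (volume : Measure ℝ) :=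
  indicatorConstLp 2 (measurableSet_Ico (a := (n : ℝ)) (b := n + a)) (by simp) 1

lemma translatedIndicator_coeFn (a : ℝ) (n : ℤ) :
    translatedIndicator a n =ᵐ[volume]
      Set.indicator (Set.Ico (n : ℝ) (n + a)) (fun _ => (1 : ℂ)) :=
  indicatorConstLp_coeFn

lemma inner_translatedIndicator (a : ℝ) (n : ℤ) (f : Lp ℂ 2 (volume : Measure ℝ)) :
    inner ℂ (translatedIndicator a n) f =
      ∫ x : ℝ, f x * conj (Set.indicator (Set.Ico (n : ℝ) (n + a)) (fun _ => (1 : ℂ)) x) := by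
  rw [L2.inner_def]
  refine integral_congr_ae ?_
  filter_upwards [translatedIndicator_coeFn a n] with x hx
  rw [hx, RCLike.inner_apply]

lemma norm_inner_translatedIndicator (a : ℝ) (m n : ℤ) :
    ‖inner ℂ (translatedIndicator a m) (translatedIndicator a n)‖ =
      max (min (m + a) (n + a) - max (m : ℝ) n) 0 := by
  rw [translatedIndicator, translatedIndicator,
    L2.inner_indicatorConstLp_one_indicatorConstLp_one _ _ (by simp) (by simp),
    Set.Ico_inter_Ico, RCLike.norm_ofReal, abs_of_nonneg measureReal_nonneg, measureReal_def,
    Real.volume_Ico, ENNReal.toReal_ofReal']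

lemma sum_norm_inner_translatedIndicator_le {a : ℝ} (ha1 : 1 < a) (ha2 : a < 2)
    (s : Finset ℤ) (n : ℤ) :
    ∑ m ∈ s.erase n, ‖inner ℂ (translatedIndicator a n) (translatedIndicator a m)‖ ≤
      2 * (a - 1) := by
  have hle : ∀ m ∈ s.erase n, ‖inner ℂ (translatedIndicator a n) (translatedIndicator a m)‖ ≤
      if m ∈ ({n - 1, n + 1} : Finset ℤ) then a - 1 else 0 := by
    intro m hm
    rw [norm_inner_translatedIndicator]
    have hne := Finset.ne_of_mem_erase hm
    split_ifs with h
    · refine max_le ?_ (by linarith)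
      simp only [Finset.mem_insert, Finset.mem_singleton] at h
      rcases h with rfl | rfl
      · have h1 := min_le_right ((n : ℝ) + a) (((n - 1 : ℤ) : ℝ) + a)
        have h2 := le_max_left (n : ℝ) ((n - 1 : ℤ) : ℝ)
        push_cast at *
        linarith
      · have h1 := min_le_left ((n : ℝ) + a) (((n + 1 : ℤ) : ℝ) + a)
        have h2 := le_max_right (n : ℝ) ((n + 1 : ℤ) : ℝ)
        push_cast at *
        linarith
    · refine max_le ?_ le_rfl
      simp only [Finset.mem_insert, Finset.mem_singleton, not_or] at h
      rcases lt_or_gt_of_ne hne with hlt | hlt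
      · have h3 : (m : ℝ) + 2 ≤ n := by exact_mod_cast (by omega : m + 2 ≤ n)
        have h1 := min_le_right ((n : ℝ) + a) ((m : ℝ) + a)
        have h2 := le_max_left (n : ℝ) (m : ℝ)
        linarith
      · have h3 : (n : ℝ) + 2 ≤ m := by exact_mod_cast (by omega : n + 2 ≤ m)
        have h1 := min_le_left ((n : ℝ) + a) ((m : ℝ) + a)
        have h2 := le_max_right (n : ℝ) (m : ℝ)
        linarith
  refine (Finset.sum_le_sum hle).trans ?_
  rw [← Finset.sum_filter, Finset.sum_const, nsmul_eq_mul]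
  refine mul_le_mul_of_nonneg_right ?_ (by linarith)
  have hcard : (Finset.filter (· ∈ ({n - 1, n + 1} : Finset ℤ)) (s.erase n)).card ≤ 2 :=
    (Finset.card_le_card fun m hm => (Finset.mem_filter.1 hm).2).trans Finset.card_le_two
  exact_mod_cast hcard

/-- For `1 < a < 2`, the family of characteristic functions `g_n = χ_{[n, n+a)}`,
`n ∈ ℤ`, is a `(2−a, 3a−2)`-frame for its closed linear span `V` in `L²(ℝ)`:
for every `f ∈ V`, `(2−a)‖f‖² ≤ Σ_n |⟨f, g_n⟩|² ≤ (3a−2)‖f‖²`, where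
`⟨f,g⟩ = ∫ f conj g`. -/
theorem stmt15 (a : ℝ) (ha1 : 1 < a) (ha2 : a < 2)
    (g : ℤ → ℝ → ℂ)
    (hgdef : ∀ n : ℤ, g n = Set.indicator (Set.Ico (n : ℝ) (n + a)) (fun _ => (1 : ℂ))) :
    ∀ f ∈ (Submodule.span ℂ
        {u : Lp ℂ 2 (volume : Measure ℝ) |
          ∃ n : ℤ, ⇑u =ᵐ[volume] g n}).topologicalClosure,
      ENNReal.ofReal ((2 - a) * ‖f‖ ^ 2) ≤
          (∑' n : ℤ, ENNReal.ofReal (‖∫ x : ℝ, f x * conj (g n x)‖ ^ 2)) ∧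
        (∑' n : ℤ, ENNReal.ofReal (‖∫ x : ℝ, f x * conj (g n x)‖ ^ 2)) ≤
          ENNReal.ofReal ((3 * a - 2) * ‖f‖ ^ 2) := by
  intro f hf
  have hset : {u : Lp ℂ 2 (volume : Measure ℝ) | ∃ n : ℤ, ⇑u =ᵐ[volume] g n} =
      Set.range (translatedIndicator a) := by
    ext u
    simp only [Set.mem_ofPred_eq, Set.mem_range, hgdef]
    refine exists_congr fun n => ⟨fun h => ?_, fun h => h ▸ translatedIndicator_coeFn a n⟩
    exact Lp.ext ((translatedIndicator_coeFn a n).trans h.symm)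
  rw [hset] at hf
  have hdiag : ∀ n, ‖translatedIndicator a n‖ ^ 2 = a := fun n => by
    have h := norm_inner_translatedIndicator a n n
    rw [inner_self_eq_norm_sq_to_K] at h
    simpa [max_eq_left (show (0 : ℝ) ≤ a by linarith)] using h
  have hgram := abs_norm_sq_sum_smul_sub_le hdiag (sum_norm_inner_translatedIndicator_le ha1 ha2)
  have hbessel := sum_norm_inner_sq_le_of_norm_sq_sum_smul_le (B := 3 * a - 2) (by linarith)
    (fun s c => by linarith [(abs_le.1 (hgram s c)).2]) f
  have hsum : Summable fun n => ‖inner ℂ (translatedIndicator a n) f‖ ^ 2 :=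
    summable_of_sum_le (fun n => sq_nonneg _) hbessel
  have hlower := mul_norm_sq_le_tsum_norm_inner_sq (A := 2 - a)
    (fun s c => by linarith [(abs_le.1 (hgram s c)).1]) hsum hf
  have htsum : ∑' n : ℤ, ENNReal.ofReal (‖∫ x : ℝ, f x * conj (g n x)‖ ^ 2) =
      ENNReal.ofReal (∑' n, ‖inner ℂ (translatedIndicator a n) f‖ ^ 2) := by
    rw [ENNReal.ofReal_tsum_of_nonneg (fun n => sq_nonneg _) hsum]
    simp only [inner_translatedIndicator, hgdef]
  rw [htsum]
  exact ⟨ENNReal.ofReal_le_ofReal hlower,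
    ENNReal.ofReal_le_ofReal (hsum.tsum_le_of_sum_le hbessel)⟩
end

section
/- Let a = √(8π) (so a² = 2πL with L = 4) and let g = (3a/2)^{-1/2} χ_{[−3a/4, 3a/4]} be the normalized characteristic function of [−3a/4, 3a/4]. For n = (n₁,n₂) ∈ ℤ² define g_n(x) = e^{ian₁x} g(x + an₂). Then ⟨g_n, g⟩ = ∫_ℝ conj(g_n(x)) g(x) dx = δ_{n₁,0} ( δ_{n₂,0} + (1/3)(δ_{n₂,1} + δ_{n₂,−1}) ). Consequently F(P) = Σ_{m∈ℤ²} ⟨g_m, g⟩ e^{i(P₁m₁+P₂m₂)} = 1 + (2/3) cos P₂. -/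
open MeasureTheory Real Complex ComplexConjugate

/-- A character of frequency `a * n` with `a ^ 2 = 8 * π` integrates over an interval whose length is
a multiple of `a / 2` to the length of the interval if `n = 0`, and to zero otherwise. -/
theorem setIntegral_Icc_exp_of_sq_eq {a : ℝ} (ha : 0 < a) (hsq : a ^ 2 = 8 * π) (n : ℤ) (k : ℕ)
    (l u : ℝ) (hu : u = l + k * (a / 2)) :
    ∫ x in Set.Icc l u, Complex.exp (-(Complex.I * a * n) * x) =
      (if n = 0 then (1 : ℂ) else 0) * (k * (a / 2)) := by
  have hlu : l ≤ u := by rw [hu]; exact le_add_of_nonneg_right (by positivity)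
  rw [integral_Icc_eq_integral_Ioc, ← intervalIntegral.integral_of_le hlu]
  split_ifs with hn
  · simp [hn, hu]
  · have hc : -(Complex.I * a * n) ≠ 0 := by simp [ha.ne', hn]
    have hsq' : (a : ℂ) ^ 2 = 8 * π := by exact_mod_cast hsq
    have hexp : -(Complex.I * a * n) * (u : ℂ) =
        -(Complex.I * a * n) * (l : ℂ) + ((-(2 * n * k) : ℤ) : ℂ) * (2 * π * Complex.I) := by
      rw [hu]
      push_cast
      linear_combination (-(Complex.I * n * k) / 2) * hsq'
    rw [integral_exp_mul_complex hc, hexp, Complex.exp_add, Complex.exp_int_mul_two_pi_mul_I]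
    simp

/-- Correlation of a normalized window on `[-3a/4, 3a/4]` with a shifted and modulated copy, when the
overlap of the supports is an interval whose length is a multiple of `a / 2`. -/
theorem integral_conj_window_mul_window {a : ℝ} (ha : 0 < a) (hsq : a ^ 2 = 8 * π) {g : ℝ → ℂ}
    (hg : ∀ x : ℝ, g x = if |x| ≤ 3 * a / 4 then (((Real.sqrt (3 * a / 2))⁻¹ : ℝ) : ℂ) else 0)
    (n : ℤ) (k : ℕ) (t l u : ℝ) (hu : u = l + k * (a / 2))
    (hsupp : ∀ x : ℝ, (|x + t| ≤ 3 * a / 4 ∧ |x| ≤ 3 * a / 4) ↔ x ∈ Set.Icc l u) :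
    ∫ x : ℝ, conj (Complex.exp (Complex.I * a * n * x) * g (x + t)) * g x =
      (if n = 0 then (1 : ℂ) else 0) * (k / 3) := by
  have hfun : (fun x : ℝ => conj (Complex.exp (Complex.I * a * n * x) * g (x + t)) * g x) =
      (Set.Icc l u).indicator
        (fun x : ℝ => ((3 * a / 2 : ℝ) : ℂ)⁻¹ * Complex.exp (-(Complex.I * a * n) * x)) := by
    funext x
    have hs : ((Real.sqrt (3 * a / 2) : ℝ) : ℂ)⁻¹ * ((Real.sqrt (3 * a / 2) : ℝ) : ℂ)⁻¹ =
        ((3 * a / 2 : ℝ) : ℂ)⁻¹ := by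
      rw [← mul_inv, ← Complex.ofReal_mul, Real.mul_self_sqrt (by positivity)]
    by_cases hx : x ∈ Set.Icc l u
    · obtain ⟨h₁, h₂⟩ := (hsupp x).2 hx
      rw [Set.indicator_of_mem hx, hg, hg, if_pos h₁, if_pos h₂, map_mul, ← Complex.exp_conj,
        Complex.conj_ofReal, Complex.ofReal_inv, mul_assoc, hs, mul_comm]
      simp
    · rw [Set.indicator_of_notMem hx, hg, hg]
      have := mt (hsupp x).1 hx
      by_cases h₁ : |x + t| ≤ 3 * a / 4
      · rw [if_neg fun h₂ => this ⟨h₁, h₂⟩, mul_zero]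
      · simp [h₁]
  rw [hfun, integral_indicator measurableSet_Icc, integral_const_mul,
    setIntegral_Icc_exp_of_sq_eq ha hsq n k l u hu]
  have ha' : (a : ℂ) ≠ 0 := by exact_mod_cast ha.ne'
  push_cast
  field_simp

/-- Windows on `[-3a/4, 3a/4]` shifted by at least `2a` do not overlap. -/
theorem not_abs_add_le_and_abs_le {a : ℝ} (ha : 0 < a) {m : ℤ} (h₀ : m ≠ 0) (h₁ : m ≠ 1)
    (h₂ : m ≠ -1) (x : ℝ) : ¬(|x + a * m| ≤ 3 * a / 4 ∧ |x| ≤ 3 * a / 4) := by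
  rintro ⟨hx, hx'⟩
  rw [abs_le] at hx hx'
  rcases (by lia : 2 ≤ m ∨ m ≤ -2) with h | h
  · have : (2 : ℝ) ≤ m := by exact_mod_cast h
    nlinarith
  · have : (m : ℝ) ≤ -2 := by exact_mod_cast h
    nlinarith

/-- Let `a = √(8π)` (so `a² = 2πL` with `L = 4`) and let
`g = (3a/2)^{-1/2} χ_{[−3a/4, 3a/4]}`.  For `n ∈ ℤ²` set
`g_n(x) = e^{ian₁x} g(x + an₂)`.  Then
`⟨g_n, g⟩ = δ_{n₁,0}(δ_{n₂,0} + (1/3)(δ_{n₂,1} + δ_{n₂,−1}))`, and consequently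
`F(P) = Σ_m ⟨g_m, g⟩ e^{i(P₁m₁+P₂m₂)} = 1 + (2/3)cos P₂`. -/
theorem stmt17 (a : ℝ) (ha : a = Real.sqrt (8 * π))
    (g : ℝ → ℂ)
    (hgdef : ∀ x : ℝ, g x = if |x| ≤ 3 * a / 4 then (((Real.sqrt (3 * a / 2))⁻¹ : ℝ) : ℂ) else 0)
    (gn : ℤ × ℤ → ℝ → ℂ)
    (hgn : ∀ n : ℤ × ℤ, ∀ x : ℝ, gn n x =
      Complex.exp (Complex.I * (a : ℂ) * (n.1 : ℂ) * (x : ℂ)) * g (x + a * n.2))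
    (I : ℤ × ℤ → ℂ) (hI : ∀ n : ℤ × ℤ, I n = ∫ x : ℝ, conj (gn n x) * g x) :
    (∀ n : ℤ × ℤ, I n =
        (if n.1 = 0 then (1 : ℂ) else 0) *
          ((if n.2 = 0 then (1 : ℂ) else 0) +
            (1 / 3) * ((if n.2 = 1 then (1 : ℂ) else 0) + (if n.2 = -1 then (1 : ℂ) else 0)))) ∧
      (∀ P : ℝ × ℝ, ∑' m : ℤ × ℤ,
          I m * Complex.exp (Complex.I * ((P.1 : ℂ) * (m.1 : ℂ) + (P.2 : ℂ) * (m.2 : ℂ))) =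
        1 + (2 / 3) * ((Real.cos P.2 : ℝ) : ℂ)) := by
  have hapos : 0 < a := by rw [ha]; positivity
  have hsq : a ^ 2 = 8 * π := by rw [ha]; exact Real.sq_sqrt (by positivity)
  have hcorr : ∀ n : ℤ × ℤ, I n =
      (if n.1 = 0 then (1 : ℂ) else 0) *
        ((if n.2 = 0 then (1 : ℂ) else 0) +
          (1 / 3) * ((if n.2 = 1 then (1 : ℂ) else 0) + (if n.2 = -1 then (1 : ℂ) else 0))) := by
    rintro ⟨n, m⟩
    simp only [hI, hgn]
    by_cases h₀ : m = 0
    · subst h₀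
      rw [integral_conj_window_mul_window hapos hsq hgdef n 3 _ (-(3 * a / 4)) (3 * a / 4)
        (by push_cast; ring) (fun x => by simp [abs_le])]
      norm_num
    by_cases h₁ : m = 1
    · subst h₁
      rw [integral_conj_window_mul_window hapos hsq hgdef n 1 _ (-(3 * a / 4)) (-(a / 4))
        (by push_cast; ring) (fun x => by
          simp only [abs_le, Set.mem_Icc, Int.cast_one]
          constructor
          · rintro ⟨⟨_, _⟩, _, _⟩
            constructor <;> linarith
          · rintro ⟨_, _⟩
            refine ⟨⟨?_, ?_⟩, ?_, ?_⟩ <;> linarith)]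
      norm_num
    by_cases h₂ : m = -1
    · subst h₂
      rw [integral_conj_window_mul_window hapos hsq hgdef n 1 _ (a / 4) (3 * a / 4)
        (by push_cast; ring) (fun x => by
          simp only [abs_le, Set.mem_Icc, Int.cast_neg, Int.cast_one]
          constructor
          · rintro ⟨⟨_, _⟩, _, _⟩
            constructor <;> linarith
          · rintro ⟨_, _⟩
            refine ⟨⟨?_, ?_⟩, ?_, ?_⟩ <;> linarith)]
      norm_num
    · have hzero : ∀ x : ℝ,
          conj (Complex.exp (Complex.I * a * n * x) * g (x + a * m)) * g x = 0 := by
        intro x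
        have := not_abs_add_le_and_abs_le hapos h₀ h₁ h₂ x
        rw [hgdef, hgdef x]
        by_cases h : |x + a * m| ≤ 3 * a / 4
        · rw [if_neg fun h' => this ⟨h, h'⟩, mul_zero]
        · simp [h]
      simp only [hzero]
      simp [h₀, h₁, h₂]
  refine ⟨hcorr, fun P => ?_⟩
  rw [tsum_eq_sum (s := {((0 : ℤ), (0 : ℤ)), (0, 1), (0, -1)})]
  · rw [Finset.sum_insert (by decide), Finset.sum_insert (by decide), Finset.sum_singleton]
    simp only [hcorr]
    rw [Complex.ofReal_cos, Complex.cos]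
    norm_num
    ring_nf
  · rintro ⟨n, m⟩ hnm
    simp only [Finset.mem_insert, Finset.mem_singleton, Prod.mk.injEq, not_or, not_and] at hnm
    rw [hcorr]
    by_cases hn : n = 0
    · simp [hnm.1 hn, hnm.2.1 hn, hnm.2.2 hn]
    · simp [hn]
end

section
/- Let L be a positive integer, a = √(2πL), and let g ∈ L²(ℝ) be defined by g(x) = a^{-1/2} cos(πx/(2a)) for |x| ≤ a and g(x) = 0 otherwise. For n = (n₁,n₂) ∈ ℤ² define g_n(x) = e^{ian₁x} g(x + an₂). Then: (i) ⟨g_{(m₁,0)}, g⟩ = δ_{m₁,0} for all m₁ ∈ ℤ; (ii) ⟨g_{(m₁,1)}, g⟩ = ⟨g_{(m₁,−1)}, g⟩ = 1/(π(1 − 4L²m₁²)) for all m₁ ∈ ℤ; (iii) ⟨g_{(m₁,m₂)}, g⟩ = 0 whenever |m₂| ≥ 2. -/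
open MeasureTheory Real Complex ComplexConjugate

/-- `∫ e^{cx} sin(ωx) dx` in closed form, away from the resonance `c² + ω² = 0`. -/
theorem integral_cexp_mul_sin {c w : ℂ} (h : c ^ 2 + w ^ 2 ≠ 0) (p q : ℝ) :
    ∫ x in p..q, Complex.exp (c * x) * Complex.sin (w * x) =
      Complex.exp (c * q) * (c * Complex.sin (w * q) - w * Complex.cos (w * q)) / (c ^ 2 + w ^ 2) -
      Complex.exp (c * p) * (c * Complex.sin (w * p) - w * Complex.cos (w * p)) /
        (c ^ 2 + w ^ 2) := by
  refine intervalIntegral.integral_eq_sub_of_hasDerivAt (f := fun x : ℝ ↦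
    Complex.exp (c * x) * (c * Complex.sin (w * x) - w * Complex.cos (w * x)) / (c ^ 2 + w ^ 2))
    (fun x _ ↦ ?_) (Continuous.intervalIntegrable (by fun_prop) _ _)
  have hlin (b : ℂ) : HasDerivAt (fun z : ℂ ↦ b * z) b (x : ℂ) := by
    simpa using (hasDerivAt_id (x : ℂ)).const_mul b
  refine HasDerivAt.congr_deriv ((hlin c).cexp.mul (((hlin w).csin.const_mul c).sub
    ((hlin w).ccos.const_mul w)) |>.div_const (c ^ 2 + w ^ 2)).comp_ofReal ?_
  rw [div_eq_iff h, Pi.sub_apply]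
  ring

/-- `∫ e^{cx} cos(ωx) dx` in closed form, away from the resonance `c² + ω² = 0`. -/
theorem integral_cexp_mul_cos {c w : ℂ} (h : c ^ 2 + w ^ 2 ≠ 0) (p q : ℝ) :
    ∫ x in p..q, Complex.exp (c * x) * Complex.cos (w * x) =
      Complex.exp (c * q) * (c * Complex.cos (w * q) + w * Complex.sin (w * q)) / (c ^ 2 + w ^ 2) -
      Complex.exp (c * p) * (c * Complex.cos (w * p) + w * Complex.sin (w * p)) /
        (c ^ 2 + w ^ 2) := by
  refine intervalIntegral.integral_eq_sub_of_hasDerivAt (f := fun x : ℝ ↦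
    Complex.exp (c * x) * (c * Complex.cos (w * x) + w * Complex.sin (w * x)) / (c ^ 2 + w ^ 2))
    (fun x _ ↦ ?_) (Continuous.intervalIntegrable (by fun_prop) _ _)
  have hlin (b : ℂ) : HasDerivAt (fun z : ℂ ↦ b * z) b (x : ℂ) := by
    simpa using (hasDerivAt_id (x : ℂ)).const_mul b
  refine HasDerivAt.congr_deriv ((hlin c).cexp.mul (((hlin w).ccos.const_mul c).add
    ((hlin w).csin.const_mul w)) |>.div_const (c ^ 2 + w ^ 2)).comp_ofReal ?_
  rw [div_eq_iff h, Pi.add_apply]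
  ring

theorem integral_eq_intervalIntegral_of_eq_zero {F f : ℝ → ℂ} {p q : ℝ} (hpq : p ≤ q)
    (hin : ∀ x ∈ Set.Icc p q, F x = f x) (hout : ∀ x ∉ Set.Icc p q, F x = 0) :
    ∫ x, F x = ∫ x in p..q, f x := by
  rw [intervalIntegral.integral_of_le hpq, ← integral_Icc_eq_integral_Ioc,
    ← setIntegral_eq_integral_of_forall_compl_eq_zero hout]
  exact setIntegral_congr_fun measurableSet_Icc hin

theorem one_sub_four_mul_sq_ne_zero (k : ℤ) : (1 - 4 * (k : ℂ) ^ 2) ≠ 0 := by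
  have h : (1 - 4 * k ^ 2 : ℤ) ≠ 0 := by omega
  exact_mod_cast h

/-- Let `L ≥ 1`, `a = √(2πL)`, and `g(x) = a^{-1/2} cos(πx/(2a))` for `|x| ≤ a`,
`g(x) = 0` otherwise.  For the Gabor family `g_n(x) = e^{ian₁x} g(x + an₂)` one has:
(i) `⟨g_{(m₁,0)}, g⟩ = δ_{m₁,0}`;
(ii) `⟨g_{(m₁,1)}, g⟩ = ⟨g_{(m₁,−1)}, g⟩ = 1/(π(1 − 4L²m₁²))`;
(iii) `⟨g_{(m₁,m₂)}, g⟩ = 0` whenever `|m₂| ≥ 2`. -/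
theorem stmt18 (L : ℕ) (hL : 0 < L) (a : ℝ) (ha : a = Real.sqrt (2 * π * L))
    (g : ℝ → ℂ)
    (hgdef : ∀ x : ℝ, g x =
      if |x| ≤ a then (((Real.sqrt a)⁻¹ * Real.cos (π * x / (2 * a)) : ℝ) : ℂ) else 0)
    (gn : ℤ × ℤ → ℝ → ℂ)
    (hgn : ∀ n : ℤ × ℤ, ∀ x : ℝ, gn n x =
      Complex.exp (Complex.I * (a : ℂ) * (n.1 : ℂ) * (x : ℂ)) * g (x + a * n.2))
    (I : ℤ × ℤ → ℂ) (hI : ∀ n : ℤ × ℤ, I n = ∫ x : ℝ, conj (gn n x) * g x) :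
    (∀ m₁ : ℤ, I (m₁, 0) = if m₁ = 0 then 1 else 0) ∧
      (∀ m₁ : ℤ,
        I (m₁, 1) = (((π * (1 - 4 * (L : ℝ) ^ 2 * (m₁ : ℝ) ^ 2))⁻¹ : ℝ) : ℂ) ∧
        I (m₁, -1) = (((π * (1 - 4 * (L : ℝ) ^ 2 * (m₁ : ℝ) ^ 2))⁻¹ : ℝ) : ℂ)) ∧
      (∀ m : ℤ × ℤ, 2 ≤ |m.2| → I m = 0) := by
  have hLpos : (0 : ℝ) < L := by exact_mod_cast hL
  have ha0 : 0 < a := by rw [ha]; positivity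
  have hasq : a ^ 2 = 2 * π * L := by rw [ha]; exact Real.sq_sqrt (by positivity)
  have hasqC : (a : ℂ) ^ 2 = 2 * π * L := by exact_mod_cast hasq
  have haC : (a : ℂ) ≠ 0 := by exact_mod_cast ha0.ne'
  have hpiC : (π : ℂ) ≠ 0 := by exact_mod_cast Real.pi_ne_zero
  have hsq : ((Real.sqrt a : ℝ) : ℂ) ^ 2 = a := by exact_mod_cast Real.sq_sqrt ha0.le
  have hsq0 : ((Real.sqrt a : ℝ) : ℂ) ≠ 0 := by
    exact_mod_cast (Real.sqrt_pos.2 ha0).ne'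
  have hg_in (x : ℝ) (hx : |x| ≤ a) :
      g x = ((Real.sqrt a : ℝ) : ℂ)⁻¹ * Complex.cos (π * x / (2 * a)) := by
    rw [hgdef, if_pos hx]; push_cast; rfl
  have hg_out (x : ℝ) (hx : a ≤ |x|) : g x = 0 := by
    rcases hx.eq_or_lt with h | h
    · rw [hgdef, if_pos h.ge]
      have hc : Real.cos (π * x / (2 * a)) = 0 := by
        rw [← Real.cos_abs, abs_div, abs_mul, ← h, abs_of_pos Real.pi_pos,
          abs_of_pos (by positivity : 0 < 2 * a),
          show π * a / (2 * a) = π / 2 by field_simp, Real.cos_pi_div_two]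
      simp [hc]
    · rw [hgdef, if_neg h.not_ge]
  have hconj (n : ℤ × ℤ) (x : ℝ) : conj (gn n x) * g x =
      Complex.exp (-(Complex.I * a * n.1) * x) * (g (x + a * n.2) * g x) := by
    have hreal (y : ℝ) : conj (g y) = g y := by
      rw [hgdef]; split_ifs <;> simp [-ofReal_mul]
    rw [hgn, map_mul, hreal, ← Complex.exp_conj]
    simp [mul_assoc]
  have hexp (m : ℤ) : Complex.exp (-(Complex.I * a * m) * a) = 1 := by
    rw [Complex.exp_eq_one_iff]
    refine ⟨-(L * m), ?_⟩
    push_cast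
    linear_combination (-Complex.I * m) * hasqC
  have hexp' (m : ℤ) : Complex.exp (-(Complex.I * a * m) * (-a : ℝ)) = 1 := by
    rw [ofReal_neg, mul_neg, Complex.exp_neg, hexp, inv_one]
  have hden (m : ℤ) : (-(Complex.I * a * m)) ^ 2 + (π / a : ℂ) ^ 2 =
      (π / a : ℂ) ^ 2 * (1 - 4 * ((L * m : ℤ) : ℂ) ^ 2) := by
    have h : (a : ℂ) ^ 4 = (2 * π * L) ^ 2 := by rw [← hasqC]; ring
    push_cast
    field_simp
    linear_combination (-m ^ 2 : ℂ) * h + (a : ℂ) ^ 4 * m ^ 2 * Complex.I_sq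
  have hden0 (m : ℤ) : (-(Complex.I * a * m)) ^ 2 + (π / a : ℂ) ^ 2 ≠ 0 := by
    rw [hden]
    exact mul_ne_zero (pow_ne_zero _ (div_ne_zero hpiC haC)) (one_sub_four_mul_sq_ne_zero _)
  have hwa : (π / a : ℂ) * a = π := by field_simp
  have hdouble (x : ℝ) : (π / a : ℂ) * x = 2 * (π * x / (2 * a)) := by field_simp
  have hfinal (m : ℤ) : (((π * (1 - 4 * (L : ℝ) ^ 2 * (m : ℝ) ^ 2))⁻¹ : ℝ) : ℂ) =
      (2 * a : ℂ)⁻¹ * (2 * (π / a) / ((-(Complex.I * a * m)) ^ 2 + (π / a : ℂ) ^ 2)) := by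
    have h := one_sub_four_mul_sq_ne_zero (L * m)
    rw [hden]
    push_cast at h ⊢
    rw [mul_pow, ← mul_assoc] at h ⊢
    field_simp
  refine ⟨fun m ↦ ?_, fun m ↦ ⟨?_, ?_⟩, fun m hm ↦ ?_⟩
  · have hprod : I (m, 0) = ∫ x in (-a)..a, (2 * a : ℂ)⁻¹ *
        (Complex.exp (-(Complex.I * a * m) * x) +
          Complex.exp (-(Complex.I * a * m) * x) * Complex.cos (π / a * x)) := by
      rw [hI]
      refine integral_eq_intervalIntegral_of_eq_zero (by linarith) (fun x hx ↦ ?_) fun x hx ↦ ?_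
      · rw [hconj, Int.cast_zero, mul_zero, add_zero, hg_in x (abs_le.2 hx), hdouble,
          Complex.cos_two_mul]
        field_simp
        rw [hsq]
        ring
      · rw [hconj, hg_out x (not_le.1 fun h ↦ hx (abs_le.1 h)).le, mul_zero, mul_zero]
    rw [hprod, intervalIntegral.integral_const_mul, intervalIntegral.integral_add
      (Continuous.intervalIntegrable (by fun_prop) _ _)
      (Continuous.intervalIntegrable (by fun_prop) _ _), integral_cexp_mul_cos (hden0 m),
      hexp, hexp', ofReal_neg, mul_neg, hwa, Complex.cos_neg, Complex.sin_neg, Complex.sin_pi]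
    split_ifs with hm
    · subst hm
      simp
      field_simp
      ring
    · have hc : -(Complex.I * a * m) ≠ 0 := by simp [haC, hm]
      rw [integral_exp_mul_complex hc, hexp, hexp']
      simp
  · have hprod : I (m, 1) = ∫ x in (-a)..0, -(2 * a : ℂ)⁻¹ *
        (Complex.exp (-(Complex.I * a * m) * x) * Complex.sin (π / a * x)) := by
      rw [hI]
      refine integral_eq_intervalIntegral_of_eq_zero (by linarith) (fun x hx ↦ ?_) fun x hx ↦ ?_
      · obtain ⟨h1, h2⟩ := hx
        have hshift : (π * (x + a : ℝ) / (2 * a) : ℂ) = π * x / (2 * a) + π / 2 := by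
          push_cast; field_simp
        rw [hconj, Int.cast_one, mul_one, hg_in x (abs_le.2 ⟨h1, by linarith⟩),
          hg_in (x + a) (abs_le.2 ⟨by linarith, by linarith⟩), hshift,
          Complex.cos_add_pi_div_two, hdouble, Complex.sin_two_mul]
        field_simp
        rw [hsq]
      · rw [hconj, Int.cast_one, mul_one]
        rcases le_or_gt x 0 with h | h
        · have h1 : x < -a := not_le.1 fun h' ↦ hx ⟨h', h⟩
          rw [hg_out x (le_abs.2 (.inr (by linarith))), mul_zero, mul_zero]
        · rw [hg_out (x + a) (le_abs.2 (.inl (by linarith))), zero_mul, mul_zero]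
    rw [hprod, intervalIntegral.integral_const_mul, integral_cexp_mul_sin (hden0 m),
      hexp', ofReal_neg, mul_neg, hwa, Complex.cos_neg, Complex.sin_neg, Complex.sin_pi,
      Complex.cos_pi, hfinal]
    simp only [ofReal_zero, mul_zero, Complex.exp_zero, Complex.sin_zero, Complex.cos_zero]
    ring
  · have hprod : I (m, -1) = ∫ x in 0..a, (2 * a : ℂ)⁻¹ *
        (Complex.exp (-(Complex.I * a * m) * x) * Complex.sin (π / a * x)) := by
      rw [hI]
      refine integral_eq_intervalIntegral_of_eq_zero ha0.le (fun x hx ↦ ?_) fun x hx ↦ ?_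
      · obtain ⟨h1, h2⟩ := hx
        have hshift : (π * (x + -a : ℝ) / (2 * a) : ℂ) = π * x / (2 * a) - π / 2 := by
          push_cast; field_simp; ring
        rw [hconj, Int.cast_neg, Int.cast_one, mul_neg_one,
          hg_in x (abs_le.2 ⟨by linarith, h2⟩),
          hg_in (x + -a) (abs_le.2 ⟨by linarith, by linarith⟩), hshift,
          Complex.cos_sub_pi_div_two, hdouble, Complex.sin_two_mul]
        field_simp
        rw [hsq]
      · rw [hconj, Int.cast_neg, Int.cast_one, mul_neg_one]
        rcases le_or_gt 0 x with h | h
        · have h1 : a < x := not_le.1 fun h' ↦ hx ⟨h, h'⟩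
          rw [hg_out x (le_abs.2 (.inl h1.le)), mul_zero, mul_zero]
        · rw [hg_out (x + -a) (le_abs.2 (.inr (by linarith))), zero_mul, mul_zero]
    rw [hprod, intervalIntegral.integral_const_mul, integral_cexp_mul_sin (hden0 m),
      hexp, hwa, Complex.sin_pi, Complex.cos_pi, hfinal]
    simp only [ofReal_zero, mul_zero, Complex.exp_zero, Complex.sin_zero, Complex.cos_zero]
    ring
  · rw [hI]
    refine integral_eq_zero_of_ae (.of_forall fun x ↦ ?_)
    change conj (gn m x) * g x = 0
    rw [hconj]
    rcases le_or_gt a |x| with h | h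
    · rw [hg_out x h, mul_zero, mul_zero]
    · have hm' : (2 : ℝ) ≤ |(m.2 : ℝ)| := by exact_mod_cast hm
      have h2 : 2 * a ≤ |a * m.2| := by
        rw [abs_mul, abs_of_pos ha0]; nlinarith
      have h3 : |a * m.2| ≤ |x + a * m.2| + |x| := by
        simpa using abs_sub (x + a * m.2) x
      rw [hg_out (x + a * m.2) (by linarith), zero_mul, mul_zero]
end
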